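/- arXiv:2302.13103 — 2 statements merged into one kernel-verified Lean document; each statement's English description precedes it below -/
import Mathlib

section
/- Let V, Y : W → ℝ be real-valued Γ-periodic potentials that are Floquet isospectral. If Y is (d₁,…,d_r) separable, then V is (d₁,…,d_r) separable. -/
open scoped BigOperators

noncomputable section

namespace DPSO

/-- The Floquet matrix `𝒟_V(z)` of the discrete periodic Schrödinger operator, indexed by the
fundamental domain `W = ∏ i, ZMod (q i)`. -/
def floquetMat {d : ℕ} (q : Fin d → ℕ) [∀ i, NeZero (q i)]
    (V : (∀ i, ZMod (q i)) → ℂ) (z : Fin d → ℂ) :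
    Matrix (∀ i, ZMod (q i)) (∀ i, ZMod (q i)) ℂ :=
  fun n n' =>
    (∑ j : Fin d,
      ((if n' = n + Pi.single j 1 then (if (n j).val = q j - 1 then z j else 1) else 0)
        + (if n' = n - Pi.single j 1 then (if (n j).val = 0 then (z j)⁻¹ else 1) else 0)))
    + (if n' = n then V n else 0)

/-- Two `Γ`-periodic potentials are Floquet isospectral if for every real quasimomentum `k`
the Floquet matrices have the same characteristic polynomial. -/
def FloquetIso {d : ℕ} (q : Fin d → ℕ) [∀ i, NeZero (q i)]
    (V Y : (∀ i, ZMod (q i)) → ℂ) : Prop :=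
  ∀ k : Fin d → ℝ,
    (floquetMat q V (fun j => Complex.exp (2 * Real.pi * Complex.I * (k j)))).charpoly
      = (floquetMat q Y (fun j => Complex.exp (2 * Real.pi * Complex.I * (k j)))).charpoly

/-- Two `Γ`-periodic potentials are Fermi isospectral if for some `λ₀` their Fermi surfaces
(inside `(ℂ∖{0})^d`) coincide. -/
def FermiIso {d : ℕ} (q : Fin d → ℕ) [∀ i, NeZero (q i)]
    (V Y : (∀ i, ZMod (q i)) → ℂ) : Prop :=
  ∃ lam : ℂ,
    {z : Fin d → ℂ | (∀ j, z j ≠ 0) ∧ (floquetMat q V z - lam • 1).det = 0}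
      = {z : Fin d → ℂ | (∀ j, z j ≠ 0) ∧ (floquetMat q Y z - lam • 1).det = 0}

/-- The offset (start index) of the `j`-th consecutive block of sizes `ds 0, …, ds (r-1)`. -/
def blockOffset {r : ℕ} (ds : Fin r → ℕ) (j : Fin r) : ℕ :=
  ∑ m ∈ Finset.univ.filter (fun m => m < j), ds m

lemma blockOffset_add_le {r : ℕ} (ds : Fin r → ℕ) (j : Fin r) :
    blockOffset ds j + ds j ≤ ∑ m, ds m := by
  have hj : j ∉ Finset.univ.filter (fun m : Fin r => m < j) := by simp
  have h : blockOffset ds j + ds j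
      = ∑ m ∈ insert j (Finset.univ.filter (fun m : Fin r => m < j)), ds m := by
    rw [Finset.sum_insert hj, Nat.add_comm, blockOffset]
  rw [h]
  exact Finset.sum_le_sum_of_subset (Finset.subset_univ _)

/-- The embedding of the index set of the `j`-th block into `Fin d`. -/
def blockEmb {d r : ℕ} (ds : Fin r → ℕ) (hsum : ∑ m, ds m = d) (j : Fin r)
    (b : Fin (ds j)) : Fin d :=
  ⟨blockOffset ds j + b.val, by
    have h1 := blockOffset_add_le ds j
    have h2 := b.isLt
    omega⟩

/-- `V` is `(d₁,…,d_r)` separable: it is a sum of functions, the `j`-th of which depends only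
on the coordinates in the `j`-th block. -/
def IsSeparable {d r : ℕ} (q : Fin d → ℕ) (ds : Fin r → ℕ) (hsum : ∑ m, ds m = d)
    (V : (∀ i, ZMod (q i)) → ℂ) : Prop :=
  ∃ F : ∀ j : Fin r, ((∀ b : Fin (ds j), ZMod (q (blockEmb ds hsum j b))) → ℂ),
    ∀ n, V n = ∑ j, F j (fun b => n (blockEmb ds hsum j b))

/-- The discrete Fourier transform of `V`. -/
def dft {d : ℕ} (q : Fin d → ℕ) [∀ i, NeZero (q i)] (V : (∀ i, ZMod (q i)) → ℂ)
    (l : ∀ i, ZMod (q i)) : ℂ :=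
  (1 / ∏ i, (q i : ℂ)) * ∑ n : ∀ i, ZMod (q i), V n *
    Complex.exp (-(2 * Real.pi * Complex.I) *
      ∑ j, ((l j).val : ℂ) * ((n j).val : ℂ) / (q j : ℂ))

/-- `ρ^j_m = e^{2πi m/q_j}`. -/
def rho {d : ℕ} (q : Fin d → ℕ) (j : Fin d) (m : ℕ) : ℂ :=
  Complex.exp (2 * Real.pi * Complex.I * (m : ℂ) / (q j : ℂ))

/-- The average `[V]` of a potential. -/
def avg {d : ℕ} (q : Fin d → ℕ) [∀ i, NeZero (q i)] (V : (∀ i, ZMod (q i)) → ℂ) : ℂ :=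
  (1 / ∏ i, (q i : ℂ)) * ∑ n, V n

/-- The diagonal matrix `A(z)`. -/
def diagA {d : ℕ} (q : Fin d → ℕ) [∀ i, NeZero (q i)] (z : Fin d → ℂ) :
    Matrix (∀ i, ZMod (q i)) (∀ i, ZMod (q i)) ℂ :=
  Matrix.diagonal (fun n => ∑ j, (rho q j ((n j).val) * z j + (rho q j ((n j).val) * z j)⁻¹))

/-- The matrix `B_V` with entries `V̂(n - n')`. -/
def matB {d : ℕ} (q : Fin d → ℕ) [∀ i, NeZero (q i)] (V : (∀ i, ZMod (q i)) → ℂ) :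
    Matrix (∀ i, ZMod (q i)) (∀ i, ZMod (q i)) ℂ :=
  fun n n' => dft q V (n - n')

/-! ### Residues -/

lemma stdAddChar_ne_one {N : ℕ} [NeZero N] {a : ZMod N} (ha : a ≠ 0) :
    (ZMod.stdAddChar a : ℂ) ≠ 1 := by
  rw [← AddChar.map_zero_eq_one (ZMod.stdAddChar (N := N))]
  exact fun h => ha (ZMod.injective_stdAddChar h)

lemma ite_mul_pow_val_add_one {N : ℕ} [NeZero N] (w : ℂ) (a : ZMod N) :
    (if a.val = N - 1 then w ^ N else 1) * w ^ (a + 1).val = w ^ a.val * w := by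
  have hN := Nat.pos_of_ne_zero (NeZero.ne N)
  have ha := a.val_lt
  split_ifs with h
  · have h0 : a + 1 = 0 := by
      have : ((a.val + 1 : ℕ) : ZMod N) = 0 := by
        rw [h, Nat.sub_add_cancel hN, ZMod.natCast_self]
      simpa using this
    rw [h0, ZMod.val_zero, h, ← pow_succ, Nat.sub_add_cancel hN, pow_zero, mul_one]
  · have h1 : (a + 1).val = a.val + 1 := by
      have : ((a.val + 1 : ℕ) : ZMod N).val = a.val + 1 :=
        ZMod.val_cast_of_lt (by omega)
      simpa using this
    rw [h1, one_mul, pow_succ]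

lemma ite_mul_pow_val_sub_one {N : ℕ} [NeZero N] {w : ℂ} (hw : w ≠ 0) (a : ZMod N) :
    (if a.val = 0 then (w ^ N)⁻¹ else 1) * w ^ (a - 1).val = w ^ a.val * w⁻¹ := by
  have h := ite_mul_pow_val_add_one w (a - 1)
  rw [sub_add_cancel] at h
  have hiff : (a - 1).val = N - 1 ↔ a.val = 0 := by
    have hN := Nat.pos_of_ne_zero (NeZero.ne N)
    have hcast : ((N - 1 : ℕ) : ZMod N) = -1 := by
      rw [Nat.cast_sub hN, ZMod.natCast_self]
      simp
    rw [ZMod.val_eq_zero]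
    constructor
    · intro h'
      have := congrArg (Nat.cast : ℕ → ZMod N) h'
      rw [ZMod.natCast_zmod_val, hcast] at this
      simpa [sub_eq_iff_eq_add] using this
    · rintro rfl
      rw [zero_sub, ← hcast, ZMod.val_cast_of_lt (by omega)]
  simp only [hiff] at h
  split_ifs at h ⊢ with h0
  · field_simp
    linear_combination -h
  · field_simp
    linear_combination -h

lemma prod_pow_val_add_single {d : ℕ} {q : Fin d → ℕ} (x : Fin d → ℂ)
    (n : ∀ i, ZMod (q i)) (j : Fin d) (a : ZMod (q j)) (c w : ℂ) (h : c * x j ^ (n j + a).val = x j ^ (n j).val * w) :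
    c * ∏ i, x i ^ ((n + Pi.single j a : ∀ i, ZMod (q i)) i).val = (∏ i, x i ^ (n i).val) * w := by
  rw [← Finset.mul_prod_erase _ _ (Finset.mem_univ j),
    ← Finset.mul_prod_erase _ (fun i => x i ^ (n i).val) (Finset.mem_univ j), ← mul_assoc,
    Pi.add_apply, Pi.single_eq_same, h]
  have : ∏ i ∈ Finset.univ.erase j, x i ^ ((n + Pi.single j a : ∀ i, ZMod (q i)) i).val
      = ∏ i ∈ Finset.univ.erase j, x i ^ (n i).val := by
    refine Finset.prod_congr rfl fun i hi => ?_
    rw [Pi.add_apply, Pi.single_eq_of_ne (Finset.ne_of_mem_erase hi), add_zero]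
  rw [this]
  ring

/-! ### Characters of the fundamental domain -/

section Characters

variable {d : ℕ} {q : Fin d → ℕ} [∀ i, NeZero (q i)]

/-- The pairing `(l, n) ↦ exp (2πi ∑ j, l j * n j / q j)` on the fundamental domain. -/
def pairing (l n : ∀ i, ZMod (q i)) : ℂ :=
  ∏ j, ZMod.stdAddChar (l j * n j)

lemma pairing_comm (l n : ∀ i, ZMod (q i)) : pairing l n = pairing n l := by
  simp [pairing, mul_comm]

lemma pairing_add_right (l m n : ∀ i, ZMod (q i)) :
    pairing l (m + n) = pairing l m * pairing l n := by
  simp [pairing, mul_add, AddChar.map_add_eq_mul, Finset.prod_mul_distrib]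

lemma pairing_add_left (l m n : ∀ i, ZMod (q i)) :
    pairing (l + m) n = pairing l n * pairing m n := by
  simp only [pairing_comm _ n, pairing_add_right]

@[simp] lemma pairing_zero_left (n : ∀ i, ZMod (q i)) : pairing 0 n = 1 := by
  simp [pairing]

@[simp] lemma pairing_zero_right (n : ∀ i, ZMod (q i)) : pairing n 0 = 1 := by
  simp [pairing]

lemma pairing_neg_left (l n : ∀ i, ZMod (q i)) : pairing (-l) n = (pairing l n)⁻¹ := by
  refine eq_inv_of_mul_eq_one_left ?_
  rw [← pairing_add_left, neg_add_cancel, pairing_zero_left]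

lemma pairing_neg_right (l n : ∀ i, ZMod (q i)) : pairing l (-n) = (pairing l n)⁻¹ := by
  rw [pairing_comm, pairing_neg_left, pairing_comm]

lemma conj_pairing (l n : ∀ i, ZMod (q i)) :
    (starRingEnd ℂ) (pairing l n) = pairing (-l) n := by
  rw [pairing, map_prod, pairing]
  refine Finset.prod_congr rfl fun j _ => ?_
  rw [← AddChar.map_neg_eq_conj]
  simp

lemma pairing_single_right (l : ∀ i, ZMod (q i)) (j : Fin d) :
    pairing l (Pi.single j 1) = ZMod.stdAddChar (l j) := by
  rw [pairing, Finset.prod_eq_single j]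
  · simp
  · intro b _ hb
    simp [Pi.single_eq_of_ne hb]
  · simp

/-- A sum against a nontrivial character of a function invariant in a direction that the
character detects vanishes. -/
lemma sum_mul_pairing_eq_zero (f : (∀ i, ZMod (q i)) → ℂ) (l : ∀ i, ZMod (q i)) (j : Fin d)
    (hf : ∀ n, f (n + Pi.single j 1) = f n) (hl : l j ≠ 0) :
    ∑ n, f n * pairing l n = 0 := by
  have h : ∑ n, f n * pairing l n = ZMod.stdAddChar (l j) * ∑ n, f n * pairing l n := by
    conv_lhs => rw [← Equiv.sum_comp (Equiv.addRight (Pi.single j 1))]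
    rw [Finset.mul_sum]
    refine Finset.sum_congr rfl fun n _ => ?_
    rw [Equiv.coe_addRight, hf, pairing_add_right, pairing_single_right]
    ring
  by_contra hne
  exact stdAddChar_ne_one hl (mul_right_cancel₀ hne (by rw [one_mul]; exact h.symm))

lemma sum_pairing (n : ∀ i, ZMod (q i)) :
    ∑ l, pairing l n = if n = 0 then (Fintype.card (∀ i, ZMod (q i)) : ℂ) else 0 := by
  split_ifs with h
  · simp [h]
  · obtain ⟨j, hj⟩ := Function.ne_iff.mp h
    have := sum_mul_pairing_eq_zero (fun _ => 1) n j (fun _ => rfl) hj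
    simpa [pairing_comm n] using this

/-- The normalized Fourier coefficient of `V` at `l`. -/
def fourier (V : (∀ i, ZMod (q i)) → ℂ) (l : ∀ i, ZMod (q i)) : ℂ :=
  (Fintype.card (∀ i, ZMod (q i)) : ℂ)⁻¹ * ∑ n, V n * pairing (-l) n

lemma card_ne_zero : (Fintype.card (∀ i, ZMod (q i)) : ℂ) ≠ 0 := by
  exact_mod_cast Fintype.card_ne_zero

lemma sum_fourier_mul_pairing (V : (∀ i, ZMod (q i)) → ℂ) (n : ∀ i, ZMod (q i)) :
    ∑ l, fourier V l * pairing l n = V n := by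
  have h (l m : ∀ i, ZMod (q i)) :
      V m * pairing (-l) m * pairing l n = V m * pairing l (n - m) := by
    rw [sub_eq_add_neg, pairing_add_right, pairing_neg_left, pairing_neg_right]
    ring
  simp only [fourier, mul_assoc, Finset.sum_mul]
  rw [← Finset.mul_sum, Finset.sum_comm]
  simp only [← mul_assoc, h, ← Finset.mul_sum, sum_pairing, sub_eq_zero]
  simp only [mul_ite, mul_zero, Finset.sum_ite_eq, Finset.mem_univ, if_true]
  rw [mul_comm (V n), inv_mul_cancel_left₀ card_ne_zero]

lemma fourier_neg_mul_fourier (V : (∀ i, ZMod (q i)) → ℝ) (l : ∀ i, ZMod (q i)) :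
    fourier (fun n => (V n : ℂ)) (-l) * fourier (fun n => (V n : ℂ)) l
      = (Complex.normSq (fourier (fun n => (V n : ℂ)) l) : ℂ) := by
  rw [← Complex.mul_conj, mul_comm]
  congr 1
  simp [fourier, conj_pairing]

/-- The symbol of the shift part `∑ j, x j • S_j` of the Floquet operator. -/
def shiftSymbol (x : Fin d → ℂ) (l : ∀ i, ZMod (q i)) : ℂ :=
  ∑ j, x j * ZMod.stdAddChar (l j)

/-- The symbol of `∑ j, (x j)⁻¹ • S_j⁻¹`. -/
def invShiftSymbol (x : Fin d → ℂ) (l : ∀ i, ZMod (q i)) : ℂ :=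
  ∑ j, (x j)⁻¹ * ZMod.stdAddChar (-l j)

/-- The Floquet operator in the Fourier basis. -/
def fourierMat (V : (∀ i, ZMod (q i)) → ℂ) (x : Fin d → ℂ) :
    Matrix (∀ i, ZMod (q i)) (∀ i, ZMod (q i)) ℂ :=
  fun l l' => (if l = l' then shiftSymbol x l + invShiftSymbol x l else 0) + fourier V (l - l')

/-- The change of basis diagonalizing the free Floquet operator at `z j = x j ^ q j`. -/
def blochMat (x : Fin d → ℂ) : Matrix (∀ i, ZMod (q i)) (∀ i, ZMod (q i)) ℂ :=
  fun n l => (∏ j, x j ^ (n j).val) * pairing l n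

lemma isUnit_det_blochMat (x : Fin d → ℂ) (hx : ∀ j, x j ≠ 0) :
    IsUnit (blochMat (q := q) x).det := by
  let P : Matrix (∀ i, ZMod (q i)) (∀ i, ZMod (q i)) ℂ :=
    fun l n => (Fintype.card (∀ i, ZMod (q i)) : ℂ)⁻¹ *
      (pairing l (-n) * (∏ j, x j ^ (n j).val)⁻¹)
  have h : blochMat x * P = 1 := by
    ext n m
    have hterm (l : ∀ i, ZMod (q i)) : blochMat x n l * P l m =
        ((∏ j, x j ^ (n j).val) * (∏ j, x j ^ (m j).val)⁻¹ *
          (Fintype.card (∀ i, ZMod (q i)) : ℂ)⁻¹) * pairing l (n - m) := by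
      simp only [blochMat, P, sub_eq_add_neg, pairing_add_right]
      ring
    rw [Matrix.mul_apply, Finset.sum_congr rfl fun l _ => hterm l, ← Finset.mul_sum, sum_pairing,
      Matrix.one_apply]
    simp only [sub_eq_zero]
    split_ifs with hnm
    · subst hnm
      have : ∏ j, x j ^ (n j).val ≠ 0 := Finset.prod_ne_zero_iff.mpr fun j _ => pow_ne_zero _ (hx j)
      rw [mul_inv_cancel₀ this, one_mul, inv_mul_cancel₀ card_ne_zero]
    · simp
  exact Matrix.isUnit_det_of_right_inverse h

lemma floquetMat_mul_blochMat (V : (∀ i, ZMod (q i)) → ℂ) (x : Fin d → ℂ) (hx : ∀ j, x j ≠ 0) :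
    floquetMat q V (fun j => x j ^ q j) * blochMat x = blochMat x * fourierMat V x := by
  ext n l
  have hpot : ∑ l', blochMat x n l' * fourier V (l' - l) = V n * blochMat x n l := by
    rw [← Equiv.sum_comp (Equiv.addRight l), ← sum_fourier_mul_pairing V n, Finset.sum_mul]
    refine Finset.sum_congr rfl fun m _ => ?_
    simp only [blochMat, Equiv.coe_addRight, add_sub_cancel_right, pairing_add_left]
    ring
  rw [Matrix.mul_apply, Matrix.mul_apply]
  simp only [floquetMat, fourierMat, add_mul, mul_add, Finset.sum_add_distrib, hpot, ite_mul,
    mul_ite, zero_mul, mul_zero, Finset.sum_ite_eq', Finset.mem_univ, if_true]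
  congr 1
  simp only [Finset.sum_mul, ite_mul, zero_mul, shiftSymbol, invShiftSymbol, Finset.mul_sum]
  congr 1
  · rw [Finset.sum_comm]
    simp only [Finset.sum_ite_eq', Finset.mem_univ, if_true]
    refine Finset.sum_congr rfl fun j _ => ?_
    have h := prod_pow_val_add_single x n j 1 _ _ (ite_mul_pow_val_add_one (x j) (n j))
    simp only [blochMat, pairing_add_right, pairing_single_right]
    split_ifs at h ⊢ <;> linear_combination pairing l n * ZMod.stdAddChar (l j) * h
  · rw [Finset.sum_comm]
    simp only [Finset.sum_ite_eq', Finset.mem_univ, if_true]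
    refine Finset.sum_congr rfl fun j _ => ?_
    have h := ite_mul_pow_val_sub_one (hx j) (n j)
    rw [sub_eq_add_neg] at h
    replace h := prod_pow_val_add_single x n j (-1) _ _ h
    rw [Pi.single_neg, ← sub_eq_add_neg] at h
    have hp : pairing l (n - Pi.single j 1) = pairing l n * ZMod.stdAddChar (-l j) := by
      rw [sub_eq_add_neg, pairing_add_right, pairing_neg_right, pairing_single_right,
        AddChar.map_neg_eq_inv]
    simp only [blochMat, hp]
    split_ifs at h ⊢ <;> linear_combination pairing l n * ZMod.stdAddChar (-l j) * h

lemma det_scalar_sub_floquetMat (V : (∀ i, ZMod (q i)) → ℂ) (x : Fin d → ℂ) (hx : ∀ j, x j ≠ 0)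
    (t : ℂ) :
    (Matrix.scalar _ t - floquetMat q V (fun j => x j ^ q j)).det
      = (Matrix.scalar _ t - fourierMat V x).det := by
  have h : (Matrix.scalar _ t - floquetMat q V (fun j => x j ^ q j)) * blochMat x
      = blochMat x * (Matrix.scalar _ t - fourierMat V x) := by
    rw [sub_mul, mul_sub, floquetMat_mul_blochMat V x hx,
      (Matrix.scalar_commute t (fun _ => Commute.all _ _) (blochMat x)).eq]
  have h' := congrArg Matrix.det h
  rw [Matrix.det_mul, Matrix.det_mul, mul_comm] at h'
  exact mul_left_cancel₀ (isUnit_det_blochMat x hx).ne_zero h'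

end Characters

/-! ### Isospectrality at positive quasimomenta -/

section Isospectral

open Filter Topology

variable {d : ℕ} {q : Fin d → ℕ} [∀ i, NeZero (q i)]

lemma differentiable_det_scalar_sub_floquetMat (V : (∀ i, ZMod (q i)) → ℂ) (t : ℂ)
    (z : ℂ → Fin d → ℂ) (hz : ∀ j, Differentiable ℂ fun s => z s j) (hz0 : ∀ s j, z s j ≠ 0) :
    Differentiable ℂ fun s => (Matrix.scalar _ t - floquetMat q V (z s)).det := by
  have hinv (j : Fin d) : Differentiable ℂ fun s => (z s j)⁻¹ := (hz j).inv fun s => hz0 s j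
  simp only [Matrix.det_apply, Matrix.sub_apply]
  refine Differentiable.fun_sum fun σ _ => Differentiable.const_smul ?_ _
  refine Differentiable.fun_finsetProd fun n _ => ?_
  refine (differentiable_const _).sub ?_
  simp only [floquetMat]
  refine Differentiable.add ?_ (differentiable_const _)
  refine Differentiable.fun_sum fun j _ => ?_
  refine Differentiable.add ?_ ?_ <;> split_ifs
  exacts [hz j, differentiable_const _, differentiable_const _, hinv j, differentiable_const _,
    differentiable_const _]

/-- Floquet isospectrality on the unit torus extends to positive real multipliers. -/
lemma FloquetIso.det_eq_of_pos {V Y : (∀ i, ZMod (q i)) → ℂ} (h : FloquetIso q V Y)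
    (z : Fin d → ℝ) (hz : ∀ j, 0 < z j) (t : ℂ) :
    (Matrix.scalar _ t - floquetMat q V fun j => (z j : ℂ)).det
      = (Matrix.scalar _ t - floquetMat q Y fun j => (z j : ℂ)).det := by
  let w : ℂ → Fin d → ℂ :=
    fun s j => Complex.exp (2 * Real.pi * Complex.I * (s * (Real.log (z j) : ℂ)))
  have hw (j : Fin d) : Differentiable ℂ fun s => w s j := by fun_prop
  have hw0 (s : ℂ) (j : Fin d) : w s j ≠ 0 := Complex.exp_ne_zero _
  have hV := differentiable_det_scalar_sub_floquetMat V t w hw hw0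
  have hY := differentiable_det_scalar_sub_floquetMat Y t w hw hw0
  have hreal (s : ℝ) : (Matrix.scalar _ t - floquetMat q V (w s)).det
      = (Matrix.scalar _ t - floquetMat q Y (w s)).det := by
    have := congrArg (Polynomial.eval t) (h fun j => s * Real.log (z j))
    simpa only [Matrix.eval_charpoly, Complex.ofReal_mul] using this
  have htendsto : Tendsto (fun s : ℝ => (s : ℂ)) (𝓝[≠] 0) (𝓝[≠] 0) := by
    refine tendsto_nhdsWithin_iff.mpr ⟨?_, ?_⟩
    · exact (Complex.continuous_ofReal.tendsto' 0 0 (by simp)).mono_left nhdsWithin_le_nhds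
    · filter_upwards [self_mem_nhdsWithin] with s hs
      simpa using hs
  have heq := AnalyticOnNhd.eq_of_frequently_eq (z₀ := 0)
    (hV.differentiableOn.analyticOnNhd isOpen_univ)
    (hY.differentiableOn.analyticOnNhd isOpen_univ)
    (htendsto.frequently (Frequently.of_forall hreal))
  have hval : w (2 * Real.pi * Complex.I)⁻¹ = fun j => (z j : ℂ) := by
    funext j
    simp only [w]
    rw [← mul_assoc, mul_inv_cancel₀ Complex.two_pi_I_ne_zero, one_mul, ← Complex.ofReal_exp,
      Real.exp_log (hz j)]
  simpa only [hval] using congrFun heq (2 * Real.pi * Complex.I)⁻¹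

lemma FloquetIso.fourier_zero_eq {V Y : (∀ i, ZMod (q i)) → ℂ} (h : FloquetIso q V Y) :
    fourier V 0 = fourier Y 0 := by
  have htr : (floquetMat q V fun j => Complex.exp (2 * Real.pi * Complex.I * (0 : ℝ))).trace
      = (floquetMat q Y fun j => Complex.exp (2 * Real.pi * Complex.I * (0 : ℝ))).trace := by
    rw [Matrix.trace_eq_neg_charpoly_coeff, Matrix.trace_eq_neg_charpoly_coeff, h fun _ => 0]
  have hsum : ∑ n, V n = ∑ n, Y n := by
    simpa [Matrix.trace, floquetMat, Finset.sum_add_distrib] using htr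
  simp [fourier, hsum]

/-- The Schur complement formula for the partition of the index set by a predicate. -/
lemma det_eq_det_toBlock_mul {ι : Type*} [Fintype ι] [DecidableEq ι] (M : Matrix ι ι ℂ)
    (p : ι → Prop) [DecidablePred p] (D D' : Matrix {i // ¬ p i} {i // ¬ p i} ℂ)
    (hD : M.toBlock (fun i => ¬ p i) (fun i => ¬ p i) = D) (hD' : D * D' = 1) :
    M.det = D.det *
      (M.toBlock p p - M.toBlock p (fun i => ¬ p i) * D' * M.toBlock (fun i => ¬ p i) p).det := by
  let := invertibleOfRightInverse D D' hD'
  rw [Matrix.det_toBlock M p, hD, Matrix.det_fromBlocks₂₂, invOf_eq_right_inv hD']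

/-- The determinant of a diagonal matrix bordered by a row and a column with zero corner. -/
lemma det_bordered_diagonal {ι : Type*} [Fintype ι] [DecidableEq ι] (o : ι) (b c δ : ι → ℂ)
    (hδ : ∀ i, i ≠ o → δ i ≠ 0) :
    (Matrix.of fun i j : ι => if i = o then (if j = o then 0 else b j)
      else if j = o then c i else if i = j then δ i else 0).det
      = -((∏ i : {i // ¬ i = o}, δ i) * ∑ i : {i // ¬ i = o}, b i * c i / δ i) := by
  have hinv : (Matrix.diagonal fun i : {i // ¬ i = o} => δ i)
      * Matrix.diagonal (fun i : {i // ¬ i = o} => (δ i)⁻¹) = 1 := by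
    rw [Matrix.diagonal_mul_diagonal, ← Matrix.diagonal_one]
    congr 1
    funext i
    exact mul_inv_cancel₀ (hδ i i.2)
  have hdet (inst : Fintype {i // i = o}) (A : Matrix {i // i = o} {i // i = o} ℂ) :
      A.det = A ⟨o, rfl⟩ ⟨o, rfl⟩ := Matrix.det_eq_elem_of_subsingleton A _
  rw [det_eq_det_toBlock_mul _ (fun i => i = o) _ _ ?_ hinv, Matrix.det_diagonal, hdet,
    Matrix.sub_apply, Matrix.mul_apply]
  swap
  · ext i j
    simp [Matrix.diagonal_apply, i.2, j.2, Subtype.ext_iff]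
  simp only [Matrix.mul_diagonal, Matrix.toBlock_apply, Matrix.of_apply, if_true, zero_sub,
    mul_neg]
  congr 2
  refine Finset.sum_congr rfl fun i _ => ?_
  simp only [i.2, if_false]
  ring

/-- The rescaled matrix `ε (t - H(x / ε))` with the factor `ε` removed from the row and the column
of the zero frequency, where `t` is the zero-frequency diagonal entry of `H(x / ε)`. -/
def borderedMat (f : (∀ i, ZMod (q i)) → ℂ) (x : Fin d → ℂ) (ε : ℂ) :
    Matrix (∀ i, ZMod (q i)) (∀ i, ZMod (q i)) ℂ :=
  Matrix.of fun l l' => if l = 0 then (if l' = 0 then 0 else -f (-l'))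
    else if l' = 0 then -f l
    else if l = l' then shiftSymbol (q := q) x 0 - shiftSymbol x l
      + ε ^ 2 * (invShiftSymbol (q := q) x 0 - invShiftSymbol x l) else -(ε * f (l - l'))

lemma scalar_sub_fourierMat (V : (∀ i, ZMod (q i)) → ℂ) (x : Fin d → ℂ) {ε : ℂ} (hε : ε ≠ 0) :
    Matrix.scalar _ (ε⁻¹ * shiftSymbol (q := q) x 0 +
        ε * invShiftSymbol (q := q) x 0 + fourier V 0) - fourierMat V (fun j => x j / ε)
      = ε⁻¹ • (Matrix.diagonal (fun l => if l = 0 then ε else 1) * borderedMat (fourier V) x ε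
          * Matrix.diagonal (fun l => if l = 0 then ε else 1)) := by
  have hs (l : ∀ i, ZMod (q i)) : shiftSymbol (fun j => x j / ε) l = ε⁻¹ * shiftSymbol x l := by
    simp only [shiftSymbol, Finset.mul_sum]
    exact Finset.sum_congr rfl fun j _ => by ring
  have hi (l : ∀ i, ZMod (q i)) :
      invShiftSymbol (fun j => x j / ε) l = ε * invShiftSymbol x l := by
    simp only [invShiftSymbol, Finset.mul_sum, inv_div]
    exact Finset.sum_congr rfl fun j _ => by ring
  ext l l'
  simp only [Matrix.sub_apply, Matrix.scalar_apply, Matrix.diagonal_apply, fourierMat, hs, hi,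
    Matrix.smul_apply, Matrix.mul_diagonal, Matrix.diagonal_mul, borderedMat, Matrix.of_apply,
    smul_eq_mul]
  by_cases hll : l = l'
  · subst hll
    by_cases hl : l = 0
    · simp [hl]
    · simp [hl]
      field_simp
      ring
  · by_cases hl : l = 0
    · have hl' : l' ≠ 0 := fun h => hll (hl.trans h.symm)
      subst hl
      simp [hl', hll, hε]
    · by_cases hl' : l' = 0
      · subst hl'
        simp [hl]
        field_simp
      · simp [hl, hl', hll, hε]

lemma shiftSymbol_zero_sub (x : Fin d → ℂ) (l : ∀ i, ZMod (q i)) :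
    shiftSymbol (q := q) x 0 - shiftSymbol x l
      = ∑ j, x j * (1 - ZMod.stdAddChar (l j)) := by
  simp [shiftSymbol, mul_sub]

lemma re_one_sub_stdAddChar_nonneg {N : ℕ} [NeZero N] (a : ZMod N) :
    0 ≤ (1 - (ZMod.stdAddChar a : ℂ)).re := by
  have h := Complex.re_le_norm (ZMod.stdAddChar a : ℂ)
  rw [AddChar.norm_apply] at h
  simpa using h

lemma re_one_sub_stdAddChar_pos {N : ℕ} [NeZero N] {a : ZMod N} (ha : a ≠ 0) :
    0 < (1 - (ZMod.stdAddChar a : ℂ)).re := by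
  refine (re_one_sub_stdAddChar_nonneg a).lt_of_ne fun h => stdAddChar_ne_one ha ?_
  have hre : (ZMod.stdAddChar a : ℂ).re = 1 := by
    rw [Complex.sub_re, Complex.one_re] at h
    linarith
  have hn : ‖(ZMod.stdAddChar a : ℂ)‖ = 1 := AddChar.norm_apply _ _
  have him := Complex.sq_norm (ZMod.stdAddChar a : ℂ)
  rw [hn, Complex.normSq_apply, hre] at him
  refine Complex.ext hre ?_
  simpa using (show (ZMod.stdAddChar a : ℂ).im * (ZMod.stdAddChar a : ℂ).im = 0 by linarith)

lemma re_sum_mul_one_sub_stdAddChar_pos {x : Fin d → ℝ} (hx : ∀ j, 0 ≤ x j)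
    {l : ∀ i, ZMod (q i)} {j : Fin d} (hj : 0 < x j) (hl : l j ≠ 0) :
    0 < (∑ j, (x j : ℂ) * (1 - ZMod.stdAddChar (l j))).re := by
  simp only [Complex.re_sum, Complex.re_ofReal_mul]
  exact Finset.sum_pos' (fun i _ => mul_nonneg (hx i) (re_one_sub_stdAddChar_nonneg _))
    ⟨j, Finset.mem_univ _, mul_pos hj (re_one_sub_stdAddChar_pos hl)⟩

lemma continuous_det_borderedMat (f : (∀ i, ZMod (q i)) → ℂ) (x : Fin d → ℂ) :
    Continuous fun ε => (borderedMat f x ε).det := by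
  refine Continuous.matrix_det (continuous_matrix fun l l' => ?_)
  simp only [borderedMat, Matrix.of_apply]
  split_ifs <;> fun_prop

lemma det_borderedMat_zero (f : (∀ i, ZMod (q i)) → ℂ) (x : Fin d → ℂ)
    (hx : ∀ l : ∀ i, ZMod (q i), l ≠ 0 → shiftSymbol (q := q) x 0 - shiftSymbol x l ≠ 0) :
    (borderedMat f x 0).det
      = -((∏ l : {l : ∀ i, ZMod (q i) // ¬ l = 0}, (shiftSymbol (q := q) x 0 - shiftSymbol x l.1)) *
        ∑ l : {l : ∀ i, ZMod (q i) // ¬ l = 0},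
          f (-l) * f l / (shiftSymbol (q := q) x 0 - shiftSymbol x l.1)) := by
  have h := det_bordered_diagonal 0 (fun l => -f (-l)) (fun l => -f l)
    (fun l => shiftSymbol (q := q) x 0 - shiftSymbol x l) hx
  simp only [neg_mul_neg] at h
  rw [← h]
  congr 1
  ext l l'
  simp [borderedMat]

/-- The second-order spectral invariant: a weighted sum of squared Fourier coefficients. -/
lemma FloquetIso.sum_normSq_fourier_div {V Y : (∀ i, ZMod (q i)) → ℝ}
    (h : FloquetIso q (fun n => (V n : ℂ)) (fun n => (Y n : ℂ)))
    (x : Fin d → ℝ) (hx : ∀ j, 0 < x j) :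
    ∑ l : {l : ∀ i, ZMod (q i) // ¬ l = 0},
        (Complex.normSq (fourier (fun n => (V n : ℂ)) l.1) : ℂ) /
          ∑ j, (x j : ℂ) * (1 - ZMod.stdAddChar (l.1 j))
      = ∑ l : {l : ∀ i, ZMod (q i) // ¬ l = 0},
        (Complex.normSq (fourier (fun n => (Y n : ℂ)) l.1) : ℂ) /
          ∑ j, (x j : ℂ) * (1 - ZMod.stdAddChar (l.1 j)) := by
  set x' : Fin d → ℂ := fun j => (x j : ℂ) with hx'
  have hne (l : ∀ i, ZMod (q i)) (hl : l ≠ 0) :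
      shiftSymbol (q := q) x' 0 - shiftSymbol x' l ≠ 0 := by
    obtain ⟨j, hj⟩ := Function.ne_iff.mp hl
    rw [shiftSymbol_zero_sub]
    intro h0
    have := re_sum_mul_one_sub_stdAddChar_pos (fun j => (hx j).le) (hx j) hj
    rw [h0] at this
    simp at this
  have hpos (ε : ℝ) (hε : 0 < ε) : (borderedMat (fourier fun n => (V n : ℂ)) x' ε).det
      = (borderedMat (fourier fun n => (Y n : ℂ)) x' ε).det := by
    have hε' : (ε : ℂ) ≠ 0 := by exact_mod_cast hε.ne'
    have hxε (j : Fin d) : x' j / (ε : ℂ) ≠ 0 :=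
      div_ne_zero (Complex.ofReal_ne_zero.mpr (hx j).ne') hε'
    have hdet := h.det_eq_of_pos (fun j => (x j / ε) ^ q j)
      (fun j => pow_pos (div_pos (hx j) hε) _) ((ε : ℂ)⁻¹ * shiftSymbol (q := q) x' 0 +
        ε * invShiftSymbol (q := q) x' 0 + fourier (fun n => (V n : ℂ)) 0)
    simp only [Complex.ofReal_pow, Complex.ofReal_div] at hdet
    rw [det_scalar_sub_floquetMat _ (fun j => x' j / (ε : ℂ)) hxε,
      det_scalar_sub_floquetMat _ (fun j => x' j / (ε : ℂ)) hxε,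
      scalar_sub_fourierMat _ _ hε', h.fourier_zero_eq, scalar_sub_fourierMat _ _ hε'] at hdet
    have hdiag : (Matrix.diagonal fun l : ∀ i, ZMod (q i) => if l = 0 then (ε : ℂ) else 1).det
        ≠ 0 := by
      rw [Matrix.det_diagonal]
      refine Finset.prod_ne_zero_iff.mpr fun l _ => ?_
      split_ifs
      exacts [hε', one_ne_zero]
    simp only [Matrix.det_smul, Matrix.det_mul] at hdet
    exact mul_left_cancel₀ hdiag
      (mul_right_cancel₀ hdiag (mul_left_cancel₀ (pow_ne_zero _ (inv_ne_zero hε')) hdet))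
  have htendsto : Tendsto (fun ε : ℝ => (ε : ℂ)) (𝓝[>] 0) (𝓝 0) :=
    (Complex.continuous_ofReal.tendsto' 0 0 (by simp)).mono_left nhdsWithin_le_nhds
  have hzero : (borderedMat (fourier fun n => (V n : ℂ)) x' 0).det
      = (borderedMat (fourier fun n => (Y n : ℂ)) x' 0).det := by
    refine tendsto_nhds_unique_of_eventuallyEq
      (((continuous_det_borderedMat _ x').tendsto 0).comp htendsto)
      (((continuous_det_borderedMat _ x').tendsto 0).comp htendsto) ?_
    filter_upwards [self_mem_nhdsWithin] with ε hε using hpos ε hε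
  rw [det_borderedMat_zero _ _ hne, det_borderedMat_zero _ _ hne] at hzero
  have hprod : ∏ l : {l : ∀ i, ZMod (q i) // ¬ l = 0},
      (shiftSymbol (q := q) x' 0 - shiftSymbol x' l.1) ≠ 0 :=
    Finset.prod_ne_zero_iff.mpr fun l _ => hne l l.2
  have := mul_left_cancel₀ hprod (neg_injective hzero)
  simpa only [fourier_neg_mul_fourier, shiftSymbol_zero_sub, hx'] using this

end Isospectral

/-! ### Block-supported frequencies -/

section Blocks

open Filter Topology

lemma blockOffset_add_le_blockOffset {r : ℕ} (ds : Fin r → ℕ) {i j : Fin r} (hij : i < j) :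
    blockOffset ds i + ds i ≤ blockOffset ds j := by
  have hi : i ∉ Finset.univ.filter (fun m : Fin r => m < i) := by simp
  rw [blockOffset, add_comm, ← Finset.sum_insert hi, blockOffset]
  refine Finset.sum_le_sum_of_subset fun m hm => ?_
  rcases Finset.mem_insert.mp hm with rfl | hm
  · simpa using hij
  · simpa using ((Finset.mem_filter.mp hm).2.trans hij)

lemma bijective_blockEmb {d r : ℕ} (ds : Fin r → ℕ) (hsum : ∑ m, ds m = d) :
    Function.Bijective fun p : Σ j, Fin (ds j) => blockEmb ds hsum p.1 p.2 := by
  refine (Fintype.bijective_iff_injective_and_card _).mpr ⟨?_, by simp [hsum]⟩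
  rintro ⟨i, a⟩ ⟨j, b⟩ h
  have hval : blockOffset ds i + a.val = blockOffset ds j + b.val := congrArg Fin.val h
  rcases lt_trichotomy i j with hij | rfl | hij
  · have := blockOffset_add_le_blockOffset ds hij
    omega
  · have : a = b := Fin.ext (by omega)
    rw [this]
  · have := blockOffset_add_le_blockOffset ds hij
    omega

/-- The block containing a given coordinate. -/
lemma exists_blockIndex {d r : ℕ} (ds : Fin r → ℕ) (hsum : ∑ m, ds m = d) :
    ∃ blk : Fin d → Fin r, (∀ j b, blk (blockEmb ds hsum j b) = j) ∧
      ∀ i, ∃ b, blockEmb ds hsum (blk i) b = i := by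
  let e := Equiv.ofBijective _ (bijective_blockEmb ds hsum)
  refine ⟨fun i => (e.symm i).1, fun j b => ?_, fun i => ⟨(e.symm i).2, e.apply_symm_apply i⟩⟩
  exact congrArg Sigma.fst (e.symm_apply_apply ⟨j, b⟩)

variable {d r : ℕ} {q : Fin d → ℕ}

/-- The frequency `l` is supported in the block `j`. -/
def IsBlockSupported (blk : Fin d → Fin r) (j : Fin r) (l : ∀ i, ZMod (q i)) : Prop :=
  ∀ i, l i ≠ 0 → blk i = j

lemma IsBlockSupported.unique {blk : Fin d → Fin r} {j j' : Fin r} {l : ∀ i, ZMod (q i)}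
    (hl : l ≠ 0) (h : IsBlockSupported blk j l) (h' : IsBlockSupported blk j' l) : j = j' := by
  obtain ⟨i, hi⟩ := Function.ne_iff.mp hl
  exact (h i hi).symm.trans (h' i hi)

open scoped Classical in
/-- A sum over nonzero frequencies splits into the block-supported parts and the rest. -/
lemma sum_eq_sum_isBlockSupported_add [∀ i, NeZero (q i)] (blk : Fin d → Fin r)
    (f : {l : ∀ i, ZMod (q i) // ¬ l = 0} → ℂ) :
    ∑ l, f l = (∑ j, ∑ l, if IsBlockSupported blk j l.1 then f l else 0) +
      ∑ l, if ∃ j, IsBlockSupported blk j l.1 then 0 else f l := by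
  rw [Finset.sum_comm, ← Finset.sum_add_distrib]
  refine Finset.sum_congr rfl fun l _ => ?_
  split_ifs with h
  · obtain ⟨j, hj⟩ := h
    rw [Finset.sum_eq_single j]
    · simp [hj]
    · intro j' _ hne
      exact if_neg fun hj' => hne (hj'.unique l.2 hj)
    · simp
  · rw [Finset.sum_eq_zero, zero_add]
    intro j _
    exact if_neg fun hj => h ⟨j, hj⟩

lemma isSeparable_of_sum {ds : Fin r → ℕ} {hsum : ∑ m, ds m = d} {V : (∀ i, ZMod (q i)) → ℂ}
    (G : Fin r → (∀ i, ZMod (q i)) → ℂ) (hV : ∀ n, V n = ∑ j, G j n)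
    (hG : ∀ j m n, (fun b => m (blockEmb ds hsum j b)) = (fun b => n (blockEmb ds hsum j b)) →
      G j m = G j n) : IsSeparable q ds hsum V := by
  classical
  refine ⟨fun j p => if h : ∃ n : ∀ i, ZMod (q i), (fun b => n (blockEmb ds hsum j b)) = p
    then G j h.choose else 0, fun n => ?_⟩
  rw [hV]
  refine Finset.sum_congr rfl fun j _ => ?_
  have h : ∃ m : ∀ i, ZMod (q i), (fun b => m (blockEmb ds hsum j b))
      = fun b => n (blockEmb ds hsum j b) := ⟨n, rfl⟩
  beta_reduce
  rw [dif_pos h]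
  exact hG j _ _ h.choose_spec.symm

variable [∀ i, NeZero (q i)]

open scoped Classical in
/-- Sending the scale outside the block `j` to infinity kills the frequencies not supported there. -/
lemma tendsto_div_sum_blockScale (blk : Fin d → Fin r) (j : Fin r) (l : ∀ i, ZMod (q i)) (c : ℂ) :
    Tendsto (fun s : ℝ => c / ∑ i, ((if blk i = j then 1 else s⁻¹ : ℝ) : ℂ) *
        (1 - ZMod.stdAddChar (l i))) (𝓝[>] 0)
      (𝓝 (if IsBlockSupported blk j l then c / ∑ i, (1 - ZMod.stdAddChar (l i)) else 0)) := by
  split_ifs with h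
  · refine tendsto_const_nhds.congr fun s => ?_
    congr 1
    refine Finset.sum_congr rfl fun i _ => ?_
    by_cases hi : l i = 0
    · simp [hi]
    · simp [h i hi]
  · simp only [IsBlockSupported, not_forall] at h
    obtain ⟨i₀, hi₀, hblk⟩ := h
    let g : ℝ → ℂ := fun s => c * s / ∑ i, ((if blk i = j then s else 1 : ℝ) : ℂ) *
      (1 - ZMod.stdAddChar (l i))
    have hg0 : ∑ i, ((if blk i = j then (0 : ℝ) else 1 : ℝ) : ℂ) * (1 - ZMod.stdAddChar (l i))
        ≠ 0 := by
      intro h0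
      have := re_sum_mul_one_sub_stdAddChar_pos (x := fun i => if blk i = j then (0 : ℝ) else 1)
        (fun i => by split_ifs <;> norm_num) (j := i₀) (by simp [hblk]) hi₀
      rw [h0] at this
      simp at this
    have hg : Tendsto g (𝓝[>] 0) (𝓝 0) := by
      have hcont : ContinuousAt g 0 := by
        refine ContinuousAt.div (by fun_prop) (Continuous.continuousAt ?_) hg0
        refine continuous_finsetSum _ fun i _ => ?_
        split_ifs <;> fun_prop
      have h0 : g 0 = 0 := by simp [g]
      simpa only [h0] using hcont.tendsto.mono_left nhdsWithin_le_nhds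
    refine hg.congr' ?_
    filter_upwards [self_mem_nhdsWithin] with s hs
    have hs' : (s : ℂ) ≠ 0 := Complex.ofReal_ne_zero.mpr (ne_of_gt hs)
    have hsum : ∑ i, ((if blk i = j then s else 1 : ℝ) : ℂ) * (1 - ZMod.stdAddChar (l i))
        = s * ∑ i, ((if blk i = j then 1 else s⁻¹ : ℝ) : ℂ) * (1 - ZMod.stdAddChar (l i)) := by
      rw [Finset.mul_sum]
      refine Finset.sum_congr rfl fun i _ => ?_
      split_ifs
      · simp
      · push_cast
        rw [← mul_assoc, mul_inv_cancel₀ hs']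
    simp only [g]
    rw [hsum, mul_comm c, mul_div_mul_left _ _ hs']

open scoped Classical in
/-- The second-order invariant restricted to frequencies supported in a single block. -/
lemma FloquetIso.sum_isBlockSupported {V Y : (∀ i, ZMod (q i)) → ℝ}
    (h : FloquetIso q (fun n => (V n : ℂ)) (fun n => (Y n : ℂ))) (blk : Fin d → Fin r)
    (j : Fin r) :
    (∑ l : {l : ∀ i, ZMod (q i) // ¬ l = 0}, if IsBlockSupported blk j l.1 then
        (Complex.normSq (fourier (fun n => (V n : ℂ)) l.1) : ℂ) /
          ∑ i, (1 - ZMod.stdAddChar (l.1 i)) else 0)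
      = ∑ l : {l : ∀ i, ZMod (q i) // ¬ l = 0}, if IsBlockSupported blk j l.1 then
        (Complex.normSq (fourier (fun n => (Y n : ℂ)) l.1) : ℂ) /
          ∑ i, (1 - ZMod.stdAddChar (l.1 i)) else 0 := by
  refine tendsto_nhds_unique_of_eventuallyEq
    (tendsto_finsetSum _ fun l _ => tendsto_div_sum_blockScale blk j l.1 _)
    (tendsto_finsetSum _ fun l _ => tendsto_div_sum_blockScale blk j l.1 _) ?_
  filter_upwards [self_mem_nhdsWithin] with s hs
  refine h.sum_normSq_fourier_div _ fun i => ?_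
  split_ifs
  exacts [one_pos, inv_pos.mpr hs]

/-- If the Fourier coefficients of `Y` vanish off the block-supported frequencies, so do those of
any real potential isospectral to it. -/
lemma FloquetIso.fourier_eq_zero {V Y : (∀ i, ZMod (q i)) → ℝ}
    (h : FloquetIso q (fun n => (V n : ℂ)) (fun n => (Y n : ℂ))) (blk : Fin d → Fin r)
    (hY : ∀ l, l ≠ 0 → (¬ ∃ j, IsBlockSupported blk j l) → fourier (fun n => (Y n : ℂ)) l = 0)
    (l : ∀ i, ZMod (q i)) (hl : l ≠ 0) (hblk : ¬ ∃ j, IsBlockSupported blk j l) :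
    fourier (fun n => (V n : ℂ)) l = 0 := by
  classical
  have htot := h.sum_normSq_fourier_div (fun _ => 1) fun _ => one_pos
  simp only [Complex.ofReal_one, one_mul] at htot
  rw [sum_eq_sum_isBlockSupported_add blk,
    sum_eq_sum_isBlockSupported_add blk (fun l : {l : ∀ i, ZMod (q i) // ¬ l = 0} =>
      (Complex.normSq (fourier (fun n => (Y n : ℂ)) l.1) : ℂ) /
        ∑ i, (1 - ZMod.stdAddChar (l.1 i))),
    Finset.sum_congr rfl fun j _ => h.sum_isBlockSupported blk j] at htot
  replace htot := add_left_cancel htot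
  rw [Finset.sum_eq_zero (s := Finset.univ) (f := fun l : {l : ∀ i, ZMod (q i) // ¬ l = 0} =>
      if ∃ j, IsBlockSupported blk j l.1 then (0 : ℂ) else
        (Complex.normSq (fourier (fun n => (Y n : ℂ)) l.1) : ℂ) /
          ∑ i, (1 - ZMod.stdAddChar (l.1 i)))
    (fun l _ => by
      split_ifs with hb
      · rfl
      · simp [hY l.1 l.2 hb])] at htot
  have hpos (m : {l : ∀ i, ZMod (q i) // ¬ l = 0}) :
      0 < ((∑ i, (1 - ZMod.stdAddChar (m.1 i)) : ℂ)⁻¹).re := by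
    obtain ⟨i, hi⟩ := Function.ne_iff.mp m.2
    have := re_sum_mul_one_sub_stdAddChar_pos (x := fun _ => 1) (fun _ => zero_le_one)
      (j := i) one_pos hi
    simp only [Complex.ofReal_one, one_mul] at this
    rw [Complex.inv_re]
    refine div_pos this (Complex.normSq_pos.mpr fun h0 => ?_)
    rw [h0] at this
    simp at this
  have hre := congrArg Complex.re htot
  rw [Complex.re_sum, Complex.zero_re, Finset.sum_eq_zero_iff_of_nonneg] at hre
  · have := hre ⟨l, hl⟩ (Finset.mem_univ _)
    rw [if_neg hblk, div_eq_mul_inv, Complex.re_ofReal_mul] at this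
    exact Complex.normSq_eq_zero.mp ((mul_eq_zero.mp this).resolve_right (hpos ⟨l, hl⟩).ne')
  · intro m _
    split_ifs
    · simp
    · rw [div_eq_mul_inv, Complex.re_ofReal_mul]
      exact mul_nonneg (Complex.normSq_nonneg _) (hpos m).le

lemma IsSeparable.fourier_eq_zero {ds : Fin r → ℕ} {hsum : ∑ m, ds m = d}
    {Y : (∀ i, ZMod (q i)) → ℂ} (hY : IsSeparable q ds hsum Y) {blk : Fin d → Fin r}
    (hblk : ∀ j b, blk (blockEmb ds hsum j b) = j) (l : ∀ i, ZMod (q i))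
    (hl : ¬ ∃ j, IsBlockSupported blk j l) : fourier Y l = 0 := by
  obtain ⟨F, hF⟩ := hY
  simp only [fourier, hF, Finset.sum_mul]
  rw [Finset.sum_comm, Finset.sum_eq_zero, mul_zero]
  intro j _
  have hj : ¬ IsBlockSupported blk j l := fun h => hl ⟨j, h⟩
  simp only [IsBlockSupported, not_forall] at hj
  obtain ⟨i, hi, hij⟩ := hj
  refine sum_mul_pairing_eq_zero (fun n => F j fun b => n (blockEmb ds hsum j b)) (-l) i
    (fun n => ?_) (neg_ne_zero.mpr hi)
  refine congrArg (F j) (funext fun b => ?_)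
  have hne : blockEmb ds hsum j b ≠ i := fun h => hij (by rw [← h, hblk])
  rw [Pi.add_apply, Pi.single_eq_of_ne hne, add_zero]

lemma IsBlockSupported.pairing_congr {ds : Fin r → ℕ} {hsum : ∑ m, ds m = d}
    {blk : Fin d → Fin r} (hblk : ∀ i, ∃ b, blockEmb ds hsum (blk i) b = i) {j : Fin r}
    {l m n : ∀ i, ZMod (q i)} (hl : IsBlockSupported blk j l)
    (hmn : (fun b => m (blockEmb ds hsum j b)) = fun b => n (blockEmb ds hsum j b)) :
    pairing l m = pairing l n := by
  refine Finset.prod_congr rfl fun i _ => ?_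
  by_cases hi : l i = 0
  · simp [hi]
  · obtain ⟨b, hb⟩ := hblk i
    obtain rfl := hl i hi
    have hi' : ∀ k, blockEmb ds hsum (blk i) b = k → m k = n k := by
      rintro _ rfl
      exact congrFun hmn b
    rw [hi' i hb]

lemma isSeparable_of_fourier_eq_zero [NeZero r] {ds : Fin r → ℕ} {hsum : ∑ m, ds m = d}
    {V : (∀ i, ZMod (q i)) → ℂ} {blk : Fin d → Fin r}
    (hblk : ∀ i, ∃ b, blockEmb ds hsum (blk i) b = i)
    (hV : ∀ l, l ≠ 0 → (¬ ∃ j, IsBlockSupported blk j l) → fourier V l = 0) :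
    IsSeparable q ds hsum V := by
  classical
  refine isSeparable_of_sum (fun j n => (if j = 0 then fourier V 0 else 0) +
    ∑ l : {l : ∀ i, ZMod (q i) // ¬ l = 0},
      if IsBlockSupported blk j l.1 then fourier V l * pairing l.1 n else 0) (fun n => ?_)
    fun j m n hmn => ?_
  · rw [Finset.sum_add_distrib, Finset.sum_ite_eq', if_pos (Finset.mem_univ _),
      ← sum_fourier_mul_pairing V n, Fintype.sum_eq_add_sum_subtype_ne _ 0, pairing_zero_left,
      mul_one]
    congr 1
    refine (sum_eq_sum_isBlockSupported_add blk _).trans ?_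
    rw [add_eq_left]
    refine Finset.sum_eq_zero fun l _ => ?_
    split_ifs with h
    · rfl
    · rw [hV l l.2 h, zero_mul]
  · congr 1
    refine Finset.sum_congr rfl fun l _ => ?_
    split_ifs with h
    · rw [h.pairing_congr hblk hmn]
    · rfl

end Blocks

/-- If real-valued Γ-periodic potentials `V` and `Y` are Floquet isospectral
and `Y` is `(d₁,…,d_r)` separable, then `V` is `(d₁,…,d_r)` separable. -/
theorem stmt0 {d r : ℕ} (hd : 1 ≤ d) (hr : 2 ≤ r)
    (q : Fin d → ℕ) [∀ i, NeZero (q i)]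
    (ds : Fin r → ℕ) (hds : ∀ j, 1 ≤ ds j) (hsum : ∑ m, ds m = d)
    (V Y : (∀ i, ZMod (q i)) → ℝ)
    (hiso : FloquetIso q (fun n => (V n : ℂ)) (fun n => (Y n : ℂ)))
    (hYsep : IsSeparable q ds hsum (fun n => (Y n : ℂ))) :
    IsSeparable q ds hsum (fun n => (V n : ℂ)) := by
  have : NeZero r := ⟨by omega⟩
  obtain ⟨blk, hblk, hblk'⟩ := exists_blockIndex ds hsum
  exact isSeparable_of_fourier_eq_zero hblk'
    (hiso.fourier_eq_zero blk fun l _ hl => hYsep.fourier_eq_zero hblk l hl)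

end DPSO
end
end

section
/- Let V, Y : W → ℝ be real-valued Γ-periodic potentials that are Floquet isospectral, and assume Y = ⊕_{j=1}^r Y_j is (d₁,…,d_r) separable. Then V = ⊕_{j=1}^r V_j is (d₁,…,d_r) separable, and moreover there exist constants c₁,…,c_r ∈ ℝ with c₁ + ⋯ + c_r = 0 such that for each j = 1,…,r the potentials V_j and Y_j + c_j are Floquet isospectral (as periodic potentials on W_j, with Floquet isospectrality defined exactly as in dimension d but with d replaced by d_j and the periods replaced by the q_b with b in the j-th block). -/
open scoped BigOperators

noncomputable section

namespace DPSO

section MatrixLemmas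

variable {n : Type*} [Fintype n] [DecidableEq n]

lemma trace_eq_of_charpoly_eq {A B : Matrix n n ℂ} (h : A.charpoly = B.charpoly) :
    A.trace = B.trace := by
  rw [Matrix.trace_eq_neg_charpoly_nextCoeff, Matrix.trace_eq_neg_charpoly_nextCoeff, h]

lemma eval_charpoly_mul_self (A : Matrix n n ℂ) (μ : ℂ) :
    (A * A).charpoly.eval (μ * μ) =
      A.charpoly.eval μ * ((-1) ^ Fintype.card n * A.charpoly.eval (-μ)) := by
  simp only [Matrix.eval_charpoly, Matrix.scalar_apply, ← Matrix.smul_one_eq_diagonal]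
  rw [← Matrix.det_neg, ← Matrix.det_mul]
  congr 1
  rw [neg_sub, neg_smul, sub_neg_eq_add, mul_add, sub_mul, sub_mul, smul_mul_smul_comm, one_mul,
    smul_mul_assoc, one_mul, mul_smul_comm, mul_one]
  abel

lemma trace_mul_self_eq_of_charpoly_eq {A B : Matrix n n ℂ} (h : A.charpoly = B.charpoly) :
    (A * A).trace = (B * B).trace := by
  refine trace_eq_of_charpoly_eq (Polynomial.funext fun x => ?_)
  obtain ⟨μ, rfl⟩ := IsAlgClosed.exists_eq_mul_self x
  rw [eval_charpoly_mul_self, eval_charpoly_mul_self, h]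

/-- A quadratic matrix pencil whose determinant is prescribed on the unit circle has its
determinant prescribed at `0`. -/
lemma det_eq_of_det_pencil_eq_on_circle {A₀ A₁ A₂ B₀ B₁ B₂ : Matrix n n ℂ}
    (h : ∀ t : ℂ, ‖t‖ = 1 →
      (A₀ + t • A₁ + t ^ 2 • A₂).det = (B₀ + t • B₁ + t ^ 2 • B₂).det) :
    A₀.det = B₀.det := by
  let P (M₀ M₁ M₂ : Matrix n n ℂ) : Polynomial ℂ :=
    (M₀.map Polynomial.C + (Polynomial.X : Polynomial ℂ) • M₁.map Polynomial.C
      + (Polynomial.X ^ 2 : Polynomial ℂ) • M₂.map Polynomial.C).det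
  have hP (M₀ M₁ M₂ : Matrix n n ℂ) (t : ℂ) :
      (P M₀ M₁ M₂).eval t = (M₀ + t • M₁ + t ^ 2 • M₂).det := by
    rw [← Polynomial.coe_evalRingHom, RingHom.map_det]
    congr 1
    ext i j
    simp [mul_comm t, mul_comm (t ^ 2)]
  have hcircle : {t : ℂ | ‖t‖ = 1}.Infinite := by
    refine Set.Infinite.of_image Complex.re ((Set.Icc_infinite (zero_lt_one' ℝ)).mono ?_)
    rintro x ⟨h0, h1⟩
    refine ⟨⟨x, √(1 - x ^ 2)⟩, ?_, rfl⟩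
    have : 0 ≤ 1 - x ^ 2 := by nlinarith
    rw [Set.mem_ofPred_eq, Complex.norm_def, Complex.normSq_mk, Real.mul_self_sqrt this]
    simp [← pow_two]
  have hPQ : P A₀ A₁ A₂ = P B₀ B₁ B₂ := by
    refine Polynomial.eq_of_infinite_eval_eq _ _ (hcircle.mono fun t ht => ?_)
    simpa only [Set.mem_ofPred_eq, hP] using h t ht
  have h0 := congrArg (Polynomial.eval 0) hPQ
  simpa [hP] using h0

end MatrixLemmas

section Shift

variable {G H : Type*} [AddCommGroup G] [Fintype G] [AddCommGroup H] [Fintype H]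

lemma card_mul_sum_comp {K : Type*} [Field K] (π : G →+ H) (hπ : Function.Surjective π)
    (f : H → K) :
    (Fintype.card H : K) * ∑ n, f (π n) = Fintype.card G * ∑ h, f h := by
  have key (h : H) : ∑ n, f (π n) = ∑ n, f (π n + h) := by
    obtain ⟨g, rfl⟩ := hπ h
    rw [← Equiv.sum_comp (Equiv.addRight g)]
    simp
  calc (Fintype.card H : K) * ∑ n, f (π n) = ∑ h : H, ∑ n, f (π n + h) := by
        rw [← Finset.sum_congr rfl fun h _ => key h]; simp
    _ = ∑ n : G, ∑ h, f h := by
        rw [Finset.sum_comm]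
        exact Finset.sum_congr rfl fun n _ => Equiv.sum_comp (Equiv.addLeft (π n)) f
    _ = _ := by simp

variable [DecidableEq H]

/-- The matrix of the pullback of functions along a homomorphism. -/
def pullMat (π : G →+ H) : Matrix G H ℂ := fun n h => if π n = h then 1 else 0

/-- The matrix of fibrewise averaging along a homomorphism. -/
def fiberAvgMat (π : G →+ H) : Matrix H G ℂ :=
  fun h n => if π n = h then (Fintype.card H : ℂ) / Fintype.card G else 0

/-- The fibrewise average of a function along a homomorphism. -/
def fiberAvg {K : Type*} [Field K] (π : G →+ H) (V : G → K) (h : H) : K :=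
  (Fintype.card H : K) / Fintype.card G * ∑ n, if π n = h then V n else 0

lemma fiberAvgMat_mul_pullMat (π : G →+ H) (hπ : Function.Surjective π) :
    fiberAvgMat π * pullMat π = 1 := by
  ext h h'
  have hG : (Fintype.card G : ℂ) ≠ 0 := by exact_mod_cast Fintype.card_ne_zero
  have := card_mul_sum_comp (K := ℂ) π hπ (fun x => if x = h then (if x = h' then 1 else 0) else 0)
  simp only [Matrix.mul_apply, fiberAvgMat, pullMat, Matrix.one_apply, mul_ite, mul_one, mul_zero]
  simp only [Finset.sum_ite_eq', Finset.mem_univ, if_true] at this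
  rw [← mul_right_inj' hG, ← this, Finset.mul_sum, Finset.mul_sum]
  refine Finset.sum_congr rfl fun n _ => ?_
  split_ifs <;> field_simp <;> simp

lemma pullMat_mul_fiberAvgMat_mulVec_of_invariant (π : G →+ H) (hπ : Function.Surjective π)
    (x : G → ℂ) (hx : ∀ n m, π n = π m → x n = x m) :
    (pullMat π * fiberAvgMat π).mulVec x = x := by
  have : x = (pullMat π).mulVec fun h => x (Function.surjInv hπ h) := by
    ext n
    simpa [Matrix.mulVec, dotProduct, pullMat] using
      hx _ _ (Function.surjInv_eq hπ (π n)).symm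
  rw [this, Matrix.mulVec_mulVec, Matrix.mul_assoc, fiberAvgMat_mul_pullMat π hπ, Matrix.mul_one]

variable [DecidableEq G]

/-- The translation matrix on a finite abelian group. -/
def shift (g : G) : Matrix G G ℂ := fun n n' => if n' = n + g then 1 else 0

lemma shift_mul_pullMat (π : G →+ H) (g : G) :
    shift g * pullMat π = pullMat π * shift (π g) := by
  ext n h
  simp only [Matrix.mul_apply, shift, pullMat, ite_mul, one_mul, zero_mul]
  simp [eq_comm]

lemma fiberAvgMat_mul_shift (π : G →+ H) {g : G} (hg : π g = 0) :
    fiberAvgMat π * shift g = fiberAvgMat π := by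
  ext h n
  have : ∀ x : G, n = x + g ↔ x = n - g := fun x => by rw [eq_sub_iff_add_eq, eq_comm]
  simp [Matrix.mul_apply, shift, fiberAvgMat, this, hg]

lemma fiberAvgMat_mul_diagonal_mul_pullMat (π : G →+ H) (V : G → ℂ) :
    fiberAvgMat π * Matrix.diagonal V * pullMat π = Matrix.diagonal (fiberAvg π V) := by
  ext h h'
  rw [Matrix.mul_apply]
  simp only [Matrix.mul_diagonal, fiberAvgMat, pullMat, Matrix.diagonal_apply, fiberAvg,
    Finset.mul_sum]
  by_cases hh : h = h'
  · subst hh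
    rw [if_pos rfl]
    refine Finset.sum_congr rfl fun n _ => ?_
    split_ifs <;> simp
  · rw [if_neg hh]
    refine Finset.sum_eq_zero fun n _ => ?_
    by_cases h1 : π n = h
    · simp [h1, hh]
    · simp [h1]

/-- The sum of weighted hoppings along `e i` and `-e i`, plus a potential, on a finite abelian
group. -/
def hop {ι : Type*} [Fintype ι] (e : ι → G) (s : ι → ℂ) (V : G → ℂ) : Matrix G G ℂ :=
  ∑ i, (s i • shift (e i) + (s i)⁻¹ • shift (-e i)) + Matrix.diagonal V

/-- A function with `∑ i ∈ S, (x n - x (n + e i)) = 0` for all `n` is invariant under the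
translations by `e i`, `i ∈ S`. -/
lemma invariant_of_sum_one_sub_shift_mulVec_eq_zero {ι : Type*} (S : Finset ι) (e : ι → G)
    (x : G → ℂ) (hx : (∑ i ∈ S, (1 - shift (e i))).mulVec x = 0) :
    ∀ i ∈ S, ∀ n, x (n + e i) = x n := by
  have hsh (g n : G) : (shift g).mulVec x n = x (n + g) := by
    simp [Matrix.mulVec, dotProduct, shift]
  have h0 (n : G) : ∑ i ∈ S, (x n - x (n + e i)) = 0 := by
    have := congrFun hx n
    rw [Matrix.sum_mulVec, Finset.sum_apply] at this
    simpa [Matrix.sub_mulVec, hsh] using this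
  have hsq (a b : ℂ) : Complex.normSq (a - b) =
      Complex.normSq b - Complex.normSq a + 2 * (starRingEnd ℂ a * (a - b)).re := by
    simp [Complex.normSq_apply]
    ring
  have htot : ∑ i ∈ S, ∑ n, Complex.normSq (x n - x (n + e i)) = 0 := by
    have h1 (i : ι) : ∑ n, Complex.normSq (x n - x (n + e i)) =
        ∑ n, 2 * (starRingEnd ℂ (x n) * (x n - x (n + e i))).re := by
      have := Equiv.sum_comp (Equiv.addRight (e i)) fun n => Complex.normSq (x n)
      simp only [Equiv.coe_addRight] at this
      simp_rw [hsq, Finset.sum_add_distrib, Finset.sum_sub_distrib, this, sub_self, zero_add]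
    simp_rw [h1]
    rw [Finset.sum_comm]
    refine Finset.sum_eq_zero fun n _ => ?_
    rw [← Finset.mul_sum, ← Complex.re_sum, ← Finset.mul_sum, h0]
    simp
  intro i hi n
  have h2 := (Finset.sum_eq_zero_iff_of_nonneg fun i _ =>
    Finset.sum_nonneg fun n _ => Complex.normSq_nonneg _).1 htot i hi
  have h3 := (Finset.sum_eq_zero_iff_of_nonneg fun n _ => Complex.normSq_nonneg _).1 h2 n
    (Finset.mem_univ n)
  exact (sub_eq_zero.1 (Complex.normSq_eq_zero.1 h3)).symm

/-- Compression of the determinant to the fibrewise constant functions. -/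
lemma det_add_avg_mul (π : G →+ H) (hπ : Function.Surjective π) (K N : Matrix G G ℂ)
    (hK : K * pullMat π = 0) :
    (K + pullMat π * fiberAvgMat π * N).det =
      (K + pullMat π * fiberAvgMat π).det * (fiberAvgMat π * N * pullMat π).det := by
  have hCR := fiberAvgMat_mul_pullMat π hπ
  set R := pullMat π
  set C := fiberAvgMat π
  have hfac : K + R * C * N = (K + R * C) * (1 + R * (C * (N - 1))) := by
    have h1 : K * (R * (C * (N - 1))) = 0 := by rw [← Matrix.mul_assoc, hK, Matrix.zero_mul]
    have h2 : R * C * (R * (C * (N - 1))) = R * C * N - R * C := by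
      rw [Matrix.mul_assoc, ← Matrix.mul_assoc C, hCR, Matrix.one_mul, Matrix.mul_sub,
        Matrix.mul_sub, Matrix.mul_one, Matrix.mul_assoc]
    rw [Matrix.add_mul, Matrix.mul_add, Matrix.mul_add, h1, h2, Matrix.mul_one, Matrix.mul_one]
    abel
  rw [hfac, Matrix.det_mul, Matrix.det_one_add_mul_comm, Matrix.mul_assoc, Matrix.sub_mul,
    Matrix.mul_sub, Matrix.one_mul, hCR, add_sub_cancel, Matrix.mul_assoc]

variable {ι κ : Type*} [Fintype ι] [Fintype κ]

/-- If the characteristic polynomials of two hopping matrices agree for all unimodular weights,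
then so do those of the hopping matrices of the fibrewise averaged potentials. -/
lemma charpoly_hop_fiberAvg_eq (emb : κ → ι) (hemb : Function.Injective emb) (π : G →+ H)
    (hπ : Function.Surjective π) (e : ι → G)
    (hker : ∀ i ∉ Set.range emb, π (e i) = 0)
    (hgen : ∀ x : G → ℂ, (∀ i ∉ Set.range emb, ∀ n, x (n + e i) = x n) →
      ∀ n m, π n = π m → x n = x m)
    (V Y : G → ℂ)
    (h : ∀ s : ι → ℂ, (∀ i, ‖s i‖ = 1) → (hop e s V).charpoly = (hop e s Y).charpoly)
    (s : κ → ℂ) (hs : ∀ b, ‖s b‖ = 1) :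
    (hop (fun b => π (e (emb b))) s (fiberAvg π V)).charpoly =
      (hop (fun b => π (e (emb b))) s (fiberAvg π Y)).charpoly := by
  classical
  refine Polynomial.funext fun μ => ?_
  have hCR := fiberAvgMat_mul_pullMat π hπ
  have hSR (g : G) := shift_mul_pullMat π g
  have hS0 : shift (0 : H) = 1 := by
    ext a b
    simp [shift, Matrix.one_apply, eq_comm]
  have hdiag (V : G → ℂ) := fiberAvgMat_mul_diagonal_mul_pullMat π V
  have hCS {g : G} (hg : π g = 0) := fiberAvgMat_mul_shift π hg
  set R := pullMat π
  set C := fiberAvgMat π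
  let S : Finset ι := Finset.univ.filter (· ∉ Set.range emb)
  have hS {i : ι} : i ∈ S ↔ i ∉ Set.range emb := by simp [S]
  let K : Matrix G G ℂ := ∑ i ∈ S, (1 - shift (e i))
  let L : Matrix G G ℂ := ∑ i ∈ S, shift (-e i)
  let N (V : G → ℂ) : Matrix G G ℂ := μ • 1 - hop (fun b => e (emb b)) s V
  have hKR : K * R = 0 := by
    rw [Matrix.sum_mul]
    refine Finset.sum_eq_zero fun i hi => ?_
    rw [Matrix.sub_mul, hSR, hker i (hS.1 hi), hS0]
    simp
  have hCK : C * K = 0 := by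
    rw [Matrix.mul_sum]
    refine Finset.sum_eq_zero fun i hi => ?_
    rw [Matrix.mul_sub, hCS (hker i (hS.1 hi))]
    simp
  have hKE : (K + R * C).det ≠ 0 := by
    intro h0
    obtain ⟨x, hx0, hx⟩ := Matrix.exists_mulVec_eq_zero_iff.2 h0
    have hE : (R * C).mulVec x = 0 := by
      have := congrArg (R * C).mulVec hx
      rw [Matrix.mulVec_mulVec, Matrix.mul_add, Matrix.mul_assoc, hCK, Matrix.mul_zero, zero_add,
        Matrix.mul_assoc, ← Matrix.mul_assoc C, hCR, Matrix.one_mul, Matrix.mulVec_zero] at this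
      exact this
    have hKx : K.mulVec x = 0 := by
      rwa [Matrix.add_mulVec, hE, add_zero] at hx
    have hinv := invariant_of_sum_one_sub_shift_mulVec_eq_zero S e x hKx
    exact hx0 ((pullMat_mul_fiberAvgMat_mulVec_of_invariant π hπ x
      (hgen x fun i hi => hinv i (hS.2 hi))).symm.trans hE)
  have hcomp (V : G → ℂ) : C * N V * R =
      Matrix.scalar H μ - hop (fun b => π (e (emb b))) s (fiberAvg π V) := by
    have hCSR (g : G) : C * shift g * R = shift (π g) := by
      rw [Matrix.mul_assoc, hSR, ← Matrix.mul_assoc, hCR, Matrix.one_mul]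
    simp only [N, hop, Matrix.mul_sub, Matrix.sub_mul, Matrix.mul_add, Matrix.add_mul,
      Matrix.mul_sum, Matrix.sum_mul, hdiag, Matrix.mul_smul, Matrix.smul_mul, hCSR, map_neg,
      Matrix.mul_one, hCR, Matrix.scalar_apply, ← Matrix.smul_one_eq_diagonal]
  have hpencil (V : G → ℂ) (t : ℂ) (ht : ‖t‖ = 1) :
      K + R * C * N V + t • ((1 - R * C) * N V - R * C * L) + t ^ 2 • (-((1 - R * C) * L)) =
        (R * C + t • (1 - R * C)) * (Matrix.scalar G (μ + S.card * t⁻¹) -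
          hop e (Function.extend emb s fun _ => t⁻¹) V) := by
    have ht0 : t ≠ 0 := norm_ne_zero_iff.1 (by simp [ht])
    have hSc : Sᶜ = Finset.univ.image emb := by
      ext i
      simp [S]
    have hhop : hop e (Function.extend emb s fun _ => t⁻¹) V =
        hop (fun b => e (emb b)) s V + t⁻¹ • ∑ i ∈ S, shift (e i) + t • L := by
      simp only [hop, L]
      rw [← Finset.sum_add_sum_compl S, hSc, Finset.sum_image hemb.injOn]
      simp only [hemb.extend_apply]
      rw [Finset.sum_congr rfl fun i hi => by
        rw [Function.extend_apply' _ _ _ (by simpa using hS.1 hi), inv_inv],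
        Finset.sum_add_distrib, ← Finset.smul_sum, ← Finset.smul_sum]
      abel
    have hsub : Matrix.scalar G (μ + S.card * t⁻¹) -
        hop e (Function.extend emb s fun _ => t⁻¹) V = N V + t⁻¹ • K - t • L := by
      have : K = (S.card : ℂ) • 1 - ∑ i ∈ S, shift (e i) := by
        simp [K, Finset.sum_sub_distrib, Nat.cast_smul_eq_nsmul]
      rw [hhop, this, Matrix.scalar_apply, ← Matrix.smul_one_eq_diagonal, add_smul, smul_sub,
        smul_smul, mul_comm t⁻¹]
      simp only [N]
      abel
    have hEK : R * C * K = 0 := by rw [Matrix.mul_assoc, hCK, Matrix.mul_zero]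
    rw [hsub]
    generalize R * C = E at hEK ⊢
    generalize N V = M
    have hmain : (E + t • (1 - E)) * (t⁻¹ • K) = K := by
      rw [Matrix.add_mul, Matrix.mul_smul, hEK, Matrix.smul_mul, Matrix.mul_smul, Matrix.sub_mul,
        hEK, smul_smul, mul_inv_cancel₀ ht0]
      simp
    rw [Matrix.mul_sub, Matrix.mul_add, hmain, Matrix.add_mul, Matrix.add_mul, Matrix.smul_mul,
      Matrix.smul_mul, Matrix.mul_smul, Matrix.mul_smul, smul_smul, ← pow_two, smul_sub, smul_neg]
    abel
  have hdet : (K + R * C * N V).det = (K + R * C * N Y).det := by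
    refine det_eq_of_det_pencil_eq_on_circle
      (A₁ := (1 - R * C) * N V - R * C * L) (A₂ := -((1 - R * C) * L))
      (B₁ := (1 - R * C) * N Y - R * C * L) (B₂ := -((1 - R * C) * L)) fun t ht => ?_
    rw [hpencil V t ht, hpencil Y t ht, Matrix.det_mul, Matrix.det_mul, ← Matrix.eval_charpoly,
      ← Matrix.eval_charpoly, h]
    intro i
    by_cases hi : ∃ b, emb b = i
    · obtain ⟨b, rfl⟩ := hi
      rw [hemb.extend_apply, hs]
    · rw [Function.extend_apply' _ _ _ hi, norm_inv, ht, inv_one]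
  rw [det_add_avg_mul π hπ _ _ hKR, det_add_avg_mul π hπ _ _ hKR] at hdet
  rw [Matrix.eval_charpoly, Matrix.eval_charpoly, ← hcomp, ← hcomp]
  exact mul_left_cancel₀ hKE hdet

end Shift

section Gauge

variable {d : ℕ} (q : Fin d → ℕ)

/-- The gauge factor relating the two forms of the Floquet matrix. -/
def gauge (s : Fin d → ℂ) (n : ∀ i, ZMod (q i)) : ℂ := ∏ i, s i ^ (n i).val

lemma gauge_ne_zero {s : Fin d → ℂ} (hs : ∀ i, s i ≠ 0) (n : ∀ i, ZMod (q i)) :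
    gauge q s n ≠ 0 :=
  Finset.prod_ne_zero_iff.2 fun i _ => pow_ne_zero _ (hs i)

variable [∀ i, NeZero (q i)]

/-- The translation-invariant form of the Floquet matrix, with weights `s` on all edges. -/
abbrev gaugedFloquet (s : Fin d → ℂ) (V : (∀ i, ZMod (q i)) → ℂ) :
    Matrix (∀ i, ZMod (q i)) (∀ i, ZMod (q i)) ℂ :=
  hop (fun i => Pi.single i 1) s V

lemma val_add_one_eq_ite {N : ℕ} [NeZero N] (a : ZMod N) :
    (a + 1).val = if a.val = N - 1 then 0 else a.val + 1 := by
  have ha := a.val_lt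
  have hN := NeZero.pos N
  have : (a + 1).val = (a.val + 1) % N := by
    rw [ZMod.val_add, ZMod.val_one_eq_one_mod, Nat.add_mod_mod]
  rw [this]
  split_ifs with h
  · rw [h, Nat.sub_add_cancel hN, Nat.mod_self]
  · exact Nat.mod_eq_of_lt (by omega)

lemma gauge_add_single (s : Fin d → ℂ) (n : ∀ i, ZMod (q i)) (j : Fin d) :
    gauge q s (n + Pi.single j 1) * (if (n j).val = q j - 1 then s j ^ q j else 1) =
      gauge q s n * s j := by
  have hrest : ∏ i ∈ Finset.univ.erase j, s i ^ ((n + Pi.single j 1 : ∀ i, ZMod (q i)) i).val =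
      ∏ i ∈ Finset.univ.erase j, s i ^ (n i).val := by
    refine Finset.prod_congr rfl fun i hi => ?_
    rw [Pi.add_apply, Pi.single_eq_of_ne (Finset.ne_of_mem_erase hi), add_zero]
  rw [gauge, gauge, ← Finset.mul_prod_erase _ _ (Finset.mem_univ j),
    ← Finset.mul_prod_erase _ _ (Finset.mem_univ j), hrest, Pi.add_apply, Pi.single_eq_same,
    val_add_one_eq_ite]
  split_ifs with h
  · have : s j ^ q j = s j ^ (n j).val * s j := by
      rw [← pow_succ, h, Nat.sub_add_cancel (NeZero.pos (q j))]
    rw [this]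
    ring
  · ring

lemma gauge_sub_single {s : Fin d → ℂ} (hs : ∀ i, s i ≠ 0) (n : ∀ i, ZMod (q i)) (j : Fin d) :
    gauge q s (n - Pi.single j 1) * (if (n j).val = 0 then (s j ^ q j)⁻¹ else 1) =
      gauge q s n * (s j)⁻¹ := by
  obtain ⟨m, rfl⟩ : ∃ m, n = m + Pi.single j 1 := ⟨n - Pi.single j 1, by simp⟩
  have h := gauge_add_single q s m j
  have hval : ((m + Pi.single j 1 : ∀ i, ZMod (q i)) j).val = 0 ↔ (m j).val = q j - 1 := by
    rw [Pi.add_apply, Pi.single_eq_same, val_add_one_eq_ite]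
    split_ifs with h <;> simp [h]
  have hsj := hs j
  simp only [add_sub_cancel_right, hval]
  split_ifs at h ⊢
  · rw [← div_eq_mul_inv, ← div_eq_mul_inv, div_eq_div_iff (pow_ne_zero _ hsj) hsj, h]
  · rw [← div_eq_mul_inv, eq_div_iff hsj, mul_one, ← h, mul_one]

lemma charpoly_floquetMat_pow {s : Fin d → ℂ} (hs : ∀ i, s i ≠ 0)
    (V : (∀ i, ZMod (q i)) → ℂ) :
    (floquetMat q V fun j => s j ^ q j).charpoly = (gaugedFloquet q s V).charpoly := by
  have hg := gauge_ne_zero q hs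
  have hconj : floquetMat q V (fun j => s j ^ q j) =
      Matrix.diagonal (gauge q s) * gaugedFloquet q s V *
        Matrix.diagonal fun n => (gauge q s n)⁻¹ := by
    ext n n'
    rw [Matrix.mul_diagonal, Matrix.diagonal_mul, ← div_eq_mul_inv, eq_div_iff (hg n'),
      gaugedFloquet, hop, floquetMat]
    simp only [Matrix.add_apply, Matrix.sum_apply, Matrix.smul_apply, smul_eq_mul, shift,
      Matrix.diagonal_apply, ← sub_eq_add_neg, mul_add, add_mul, Finset.sum_mul, Finset.mul_sum]
    congr 1
    · refine Finset.sum_congr rfl fun j _ => ?_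
      congr 1
      · split_ifs with h1 h2 <;> simp only [mul_one, one_mul, mul_zero, zero_mul]
        all_goals
          subst h1
          have := gauge_add_single q s n j
          simp only [h2, if_true, if_false, mul_one] at this
          rw [← this]
          try ring
      · split_ifs with h1 h2 <;> simp only [mul_one, one_mul, mul_zero, zero_mul]
        all_goals
          subst h1
          have := gauge_sub_single q hs n j
          simp only [h2, if_true, if_false, mul_one] at this
          rw [← this]
          try ring
    · by_cases h : n' = n
      · subst h
        simp [mul_comm]
      · simp [h, Ne.symm h]
  rw [hconj, Matrix.charpoly_mul_comm, ← Matrix.mul_assoc, Matrix.diagonal_mul_diagonal]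
  simp [hg]

lemma floquetIso_iff (V Y : (∀ i, ZMod (q i)) → ℂ) :
    FloquetIso q V Y ↔ ∀ s : Fin d → ℂ, (∀ i, ‖s i‖ = 1) →
      (gaugedFloquet q s V).charpoly = (gaugedFloquet q s Y).charpoly := by
  have hq (j : Fin d) : (q j : ℂ) ≠ 0 := Nat.cast_ne_zero.2 (NeZero.ne _)
  constructor
  · intro h s hs
    have hs0 (i : Fin d) : s i ≠ 0 := norm_ne_zero_iff.1 (by simp [hs])
    have hz : (fun j => Complex.exp (2 * Real.pi * Complex.I *
        ((q j * (s j).arg / (2 * Real.pi) : ℝ) : ℂ))) = fun j => s j ^ q j := by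
      funext j
      have hpi : (Real.pi : ℂ) ≠ 0 := Complex.ofReal_ne_zero.2 Real.pi_ne_zero
      have h1 : s j = Complex.exp ((s j).arg * Complex.I) := by
        simpa [hs] using (Complex.norm_mul_exp_arg_mul_I (s j)).symm
      conv_rhs => rw [h1]
      rw [← Complex.exp_nat_mul]
      congr 1
      push_cast
      field_simp
    have := h fun j => q j * (s j).arg / (2 * Real.pi)
    rwa [hz, charpoly_floquetMat_pow q hs0, charpoly_floquetMat_pow q hs0] at this
  · intro h k
    let s : Fin d → ℂ := fun j => Complex.exp ((2 * Real.pi * k j / q j : ℝ) * Complex.I)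
    have hz : (fun j => Complex.exp (2 * Real.pi * Complex.I * (k j))) = fun j => s j ^ q j := by
      funext j
      rw [← Complex.exp_nat_mul]
      congr 1
      have := hq j
      push_cast
      field_simp
    have hs0 (i : Fin d) : s i ≠ 0 := Complex.exp_ne_zero _
    rw [hz, charpoly_floquetMat_pow q hs0, charpoly_floquetMat_pow q hs0]
    exact h s fun i => Complex.norm_exp_ofReal_mul_I _

end Gauge

lemma charpoly_add_smul_one_eq {n : Type*} [Fintype n] [DecidableEq n] {A B : Matrix n n ℂ}
    (h : A.charpoly = B.charpoly) (c : ℂ) :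
    (A + c • (1 : Matrix n n ℂ)).charpoly = (B + c • (1 : Matrix n n ℂ)).charpoly := by
  have key (M : Matrix n n ℂ) (μ : ℂ) :
      (M + c • (1 : Matrix n n ℂ)).charpoly.eval μ = M.charpoly.eval (μ - c) := by
    rw [Matrix.eval_charpoly, Matrix.eval_charpoly, map_sub, Matrix.smul_one_eq_diagonal,
      Matrix.scalar_apply, Matrix.scalar_apply]
    congr 1
    abel
  exact Polynomial.funext fun μ => by rw [key, key, h]

lemma FloquetIso.add_const {d : ℕ} {q : Fin d → ℕ} [∀ i, NeZero (q i)]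
    {V Y : (∀ i, ZMod (q i)) → ℂ} (h : FloquetIso q V Y) (c : ℂ) :
    FloquetIso q (fun n => V n + c) (fun n => Y n + c) := by
  have key (V : (∀ i, ZMod (q i)) → ℂ) (z : Fin d → ℂ) :
      floquetMat q (fun n => V n + c) z = floquetMat q V z + c • 1 := by
    ext n n'
    by_cases hn : n' = n
    · subst hn
      simp [floquetMat, add_assoc]
    · simp [floquetMat, hn, Matrix.one_apply_ne' hn]
  intro k
  rw [key, key]
  exact charpoly_add_smul_one_eq (h k) c

section Moments

variable {G : Type*} [AddCommGroup G] [Fintype G] [DecidableEq G] {ι : Type*} [Fintype ι]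

lemma hop_moments_eq (e : ι → G) (s : ι → ℂ) (V Y : G → ℂ)
    (h : (hop e s V).charpoly = (hop e s Y).charpoly) :
    ∑ n, V n = ∑ n, Y n ∧ ∑ n, V n ^ 2 = ∑ n, Y n ^ 2 := by
  let A : Matrix G G ℂ := ∑ i, (s i • shift (e i) + (s i)⁻¹ • shift (-e i))
  have hA (n : G) : A n n = A 0 0 := by
    simp [A, Matrix.sum_apply, shift, eq_comm (a := (0 : G))]
  have htr (V : G → ℂ) : (hop e s V).trace = A.trace + ∑ n, V n := by
    rw [hop, Matrix.trace_add, Matrix.trace_diagonal]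
  have htr2 (V : G → ℂ) : (hop e s V * hop e s V).trace =
      (A * A).trace + 2 * (A 0 0 * ∑ n, V n) + ∑ n, V n ^ 2 := by
    have hAD : (A * Matrix.diagonal V).trace = A 0 0 * ∑ n, V n := by
      simp [Matrix.trace, Matrix.mul_diagonal, hA, Finset.mul_sum]
    have : hop e s V = A + Matrix.diagonal V := rfl
    rw [this, Matrix.add_mul, Matrix.mul_add, Matrix.mul_add, Matrix.trace_add, Matrix.trace_add,
      Matrix.trace_add, Matrix.trace_mul_comm (Matrix.diagonal V) A, hAD,
      Matrix.diagonal_mul_diagonal, Matrix.trace_diagonal]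
    simp only [pow_two]
    ring
  have h1 := trace_eq_of_charpoly_eq h
  have h2 := trace_mul_self_eq_of_charpoly_eq h
  rw [htr, htr, add_right_inj] at h1
  rw [htr2, htr2, h1, add_right_inj] at h2
  exact ⟨h1, h2⟩

lemma FloquetIso.moments_eq {d : ℕ} {q : Fin d → ℕ} [∀ i, NeZero (q i)]
    {V Y : (∀ i, ZMod (q i)) → ℝ}
    (h : FloquetIso q (fun n => (V n : ℂ)) (fun n => (Y n : ℂ))) :
    ∑ n, V n = ∑ n, Y n ∧ ∑ n, V n ^ 2 = ∑ n, Y n ^ 2 := by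
  have := hop_moments_eq _ _ _ _ ((floquetIso_iff q _ _).1 h (fun _ => 1) (by simp))
  exact_mod_cast this

end Moments

section Restriction

variable {d k : ℕ} (q : Fin d → ℕ) (emb : Fin k → Fin d)

/-- Restriction to the coordinates in the image of `emb`. -/
def restrictHom : (∀ i, ZMod (q i)) →+ (∀ b, ZMod (q (emb b))) where
  toFun n b := n (emb b)
  map_zero' := rfl
  map_add' _ _ := rfl

/-- Extension by zero from the coordinates in the image of `emb`. -/
def extendZero (h : ∀ b, ZMod (q (emb b))) : ∀ i, ZMod (q i) :=
  ∑ b, Pi.single (emb b) (h b)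

lemma restrictHom_extendZero (hemb : Function.Injective emb) (h : ∀ b, ZMod (q (emb b))) :
    restrictHom q emb (extendZero q emb h) = h := by
  funext b
  change (∑ c, Pi.single (emb c) (h c) : ∀ i, ZMod (q i)) (emb b) = h b
  rw [Finset.sum_apply, Finset.sum_eq_single b]
  · exact Pi.single_eq_same _ _
  · intro c _ hc
    exact Pi.single_eq_of_ne (fun hbc => hc (hemb hbc).symm) _
  · simp

lemma restrictHom_extendZero_of_disjoint {l : ℕ} (emb' : Fin l → Fin d)
    (hdisj : ∀ b c, emb b ≠ emb' c) (h : ∀ c, ZMod (q (emb' c))) :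
    restrictHom q emb (extendZero q emb' h) = 0 := by
  funext b
  change (∑ c, Pi.single (emb' c) (h c) : ∀ i, ZMod (q i)) (emb b) = 0
  rw [Finset.sum_apply]
  exact Finset.sum_eq_zero fun c _ => Pi.single_eq_of_ne (hdisj b c) _

lemma restrictHom_surjective (hemb : Function.Injective emb) :
    Function.Surjective (restrictHom q emb) := fun h =>
  ⟨_, restrictHom_extendZero q emb hemb h⟩

lemma restrictHom_single (hemb : Function.Injective emb) (b : Fin k) :
    restrictHom q emb (Pi.single (emb b) 1) = Pi.single b 1 := by
  funext c
  change (Pi.single (emb b) 1 : ∀ i, ZMod (q i)) (emb c) = _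
  by_cases hc : c = b
  · subst hc
    rw [Pi.single_eq_same, Pi.single_eq_same]
  · rw [Pi.single_eq_of_ne hc, Pi.single_eq_of_ne (hemb.ne hc)]

variable [∀ i, NeZero (q i)]

/-- A function invariant under all unit translations outside the image of `emb` only depends on
the coordinates in the image of `emb`. -/
lemma eq_of_restrictHom_eq (x : (∀ i, ZMod (q i)) → ℂ)
    (hx : ∀ i ∉ Set.range emb, ∀ n, x (n + Pi.single i 1) = x n)
    (n m : ∀ i, ZMod (q i)) (hnm : restrictHom q emb n = restrictHom q emb m) : x n = x m := by
  let P : AddSubgroup (∀ i, ZMod (q i)) :=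
    { carrier := {g | ∀ n, x (n + g) = x n}
      zero_mem' := fun n => by rw [add_zero]
      add_mem' := fun {a b} ha hb n => by rw [← add_assoc, hb, ha]
      neg_mem' := fun {a} ha n => by rw [← ha (n + -a), neg_add_cancel_right] }
  have hsingle (i : Fin d) (hi : i ∉ Set.range emb) (a : ZMod (q i)) : Pi.single i a ∈ P := by
    have : Pi.single i a = a.val • (Pi.single i 1 : ∀ i, ZMod (q i)) := by
      rw [← Pi.single_smul]
      simp
    rw [this]
    exact P.nsmul_mem (hx i hi) _
  have hmem : n - m ∈ P := by
    rw [← Finset.univ_sum_single (n - m)]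
    refine P.sum_mem fun i _ => ?_
    by_cases hi : i ∈ Set.range emb
    · obtain ⟨b, rfl⟩ := hi
      have : (n - m) (emb b) = 0 := sub_eq_zero.2 (congrFun hnm b)
      rw [this, Pi.single_zero]
      exact P.zero_mem
    · exact hsingle i hi _
  have := hmem m
  rwa [add_sub_cancel] at this

variable {q}

/-- Averaging over the coordinates outside the image of `emb` preserves Floquet
isospectrality. -/
lemma FloquetIso.fiberAvg {V Y : (∀ i, ZMod (q i)) → ℂ} (h : FloquetIso q V Y)
    (hemb : Function.Injective emb) :
    FloquetIso (fun b => q (emb b)) (fiberAvg (restrictHom q emb) V)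
      (fiberAvg (restrictHom q emb) Y) := by
  rw [floquetIso_iff] at h ⊢
  intro s hs
  have := charpoly_hop_fiberAvg_eq emb hemb (restrictHom q emb)
    (restrictHom_surjective q emb hemb) (fun i => Pi.single i 1) ?_
    (eq_of_restrictHom_eq q emb) V Y h s hs
  · simpa only [restrictHom_single q emb hemb] using this
  · intro i hi
    funext b
    exact Pi.single_eq_of_ne (fun hb => hi ⟨b, hb⟩) _

end Restriction

section Orthogonality

variable {G : Type*} [AddCommGroup G] [Fintype G]

lemma card_mul_sum_comp_mul_comp {H H' : Type*} [AddCommGroup H] [AddCommGroup H'] [Fintype H']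
    (π : G →+ H) (π' : G →+ H') (hind : ∀ h : H', ∃ g, π g = 0 ∧ π' g = h)
    (f : H → ℝ) (f' : H' → ℝ) :
    (Fintype.card H' : ℝ) * ∑ n, f (π n) * f' (π' n) = (∑ n, f (π n)) * ∑ h, f' h := by
  have key (h : H') : ∑ n, f (π n) * f' (π' n) = ∑ n, f (π n) * f' (π' n + h) := by
    obtain ⟨g, hg, rfl⟩ := hind h
    rw [← Equiv.sum_comp (Equiv.addRight g)]
    simp [hg]
  calc (Fintype.card H' : ℝ) * ∑ n, f (π n) * f' (π' n)
      = ∑ h : H', ∑ n, f (π n) * f' (π' n + h) := by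
        rw [← Finset.sum_congr rfl fun h _ => key h]; simp
    _ = ∑ n, f (π n) * ∑ h, f' h := by
        rw [Finset.sum_comm]
        refine Finset.sum_congr rfl fun n _ => ?_
        rw [← Finset.mul_sum]
        congr 1
        exact Equiv.sum_comp (Equiv.addLeft (π' n)) f'
    _ = _ := by rw [Finset.sum_mul]

variable {H : Type*} [AddCommGroup H] [Fintype H] [DecidableEq H]

lemma sum_comp_mul_eq_sum_comp_mul_fiberAvg (π : G →+ H) (hπ : Function.Surjective π)
    (f : H → ℝ) (V : G → ℝ) :
    ∑ n, f (π n) * V n = ∑ n, f (π n) * fiberAvg π V (π n) := by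
  have hH : (Fintype.card H : ℝ) ≠ 0 := by exact_mod_cast Fintype.card_ne_zero
  have hG : (Fintype.card G : ℝ) ≠ 0 := by exact_mod_cast Fintype.card_ne_zero
  have h := card_mul_sum_comp π hπ fun h => f h * fiberAvg π V h
  rw [← mul_right_inj' hH, h, Finset.mul_sum, Finset.mul_sum]
  have h1 (x : H) : (Fintype.card G : ℝ) * (f x * fiberAvg π V x) =
      ∑ n, if π n = x then Fintype.card H * (f (π n) * V n) else 0 := by
    rw [fiberAvg, Finset.mul_sum, Finset.mul_sum, Finset.mul_sum]
    refine Finset.sum_congr rfl fun n _ => ?_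
    split_ifs with hx
    · rw [hx]
      field_simp
    · simp
  simp_rw [h1]
  rw [Finset.sum_comm]
  simp

lemma fiberAvg_comp_self (π : G →+ H) (hπ : Function.Surjective π) (f : H → ℝ) (h : H) :
    fiberAvg π (fun n => f (π n)) h = f h := by
  have hG : (Fintype.card G : ℝ) ≠ 0 := by exact_mod_cast Fintype.card_ne_zero
  have := card_mul_sum_comp π hπ fun x => if x = h then f x else 0
  simp only [Finset.sum_ite_eq', Finset.mem_univ, if_true] at this
  rw [fiberAvg, div_mul_eq_mul_div, this, mul_div_cancel_left₀ _ hG]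

lemma fiberAvg_comp_of_indep {H' : Type*} [AddCommGroup H'] [Fintype H'] (π : G →+ H)
    (hπ : Function.Surjective π) (π' : G →+ H') (hind : ∀ h : H', ∃ g, π g = 0 ∧ π' g = h)
    (f : H' → ℝ) (h : H) :
    fiberAvg π (fun n => f (π' n)) h = (∑ x, f x) / Fintype.card H' := by
  have hG : (Fintype.card G : ℝ) ≠ 0 := by exact_mod_cast Fintype.card_ne_zero
  have hH' : (Fintype.card H' : ℝ) ≠ 0 := by exact_mod_cast Fintype.card_ne_zero
  have h1 := card_mul_sum_comp_mul_comp π π' hind (fun x => if x = h then 1 else 0) f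
  have h2 := card_mul_sum_comp (K := ℝ) π hπ fun x => if x = h then 1 else 0
  simp only [Finset.sum_ite_eq', Finset.mem_univ, if_true, mul_one] at h2
  simp only [ite_mul, one_mul, zero_mul] at h1
  rw [fiberAvg, eq_div_iff hH', div_mul_eq_mul_div, div_mul_eq_mul_div, div_eq_iff hG, ← h2]
  linear_combination (Fintype.card H : ℝ) * h1

lemma sum_sub_sum_sq {ι : Type*} [Fintype ι] {X : Type*} [Fintype X] (U : X → ℝ)
    (W : ι → X → ℝ) (horth : ∀ i j, i ≠ j → ∑ n, W i n * W j n = 0)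
    (hproj : ∀ j, ∑ n, W j n * U n = ∑ n, W j n ^ 2) :
    ∑ n, (U n - ∑ j, W j n) ^ 2 = ∑ n, U n ^ 2 - ∑ j, ∑ n, W j n ^ 2 := by
  have h1 : ∑ n, (∑ j, W j n) * U n = ∑ j, ∑ n, W j n ^ 2 := by
    simp_rw [Finset.sum_mul]
    rw [Finset.sum_comm]
    exact Finset.sum_congr rfl fun j _ => hproj j
  have h2 : ∑ n, (∑ j, W j n) * (∑ j, W j n) = ∑ j, ∑ n, W j n ^ 2 := by
    simp_rw [Finset.sum_mul_sum]
    rw [Finset.sum_comm]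
    refine Finset.sum_congr rfl fun i _ => ?_
    rw [Finset.sum_comm, Finset.sum_eq_single i (fun j _ hj => horth i j hj.symm) (by simp)]
    simp only [pow_two]
  calc ∑ n, (U n - ∑ j, W j n) ^ 2
      = ∑ n, (U n ^ 2 - 2 * ((∑ j, W j n) * U n) + (∑ j, W j n) * (∑ j, W j n)) :=
        Finset.sum_congr rfl fun n _ => by ring
    _ = _ := by
        rw [Finset.sum_add_distrib, Finset.sum_sub_distrib, ← Finset.mul_sum, h1, h2]
        ring

lemma sum_sub_const_sq_eq {X : Type*} [Fintype X] {f g : X → ℝ} (c : ℝ)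
    (h1 : ∑ x, f x = ∑ x, g x) (h2 : ∑ x, f x ^ 2 = ∑ x, g x ^ 2) :
    ∑ x, (f x - c) ^ 2 = ∑ x, (g x - c) ^ 2 := by
  have key (f : X → ℝ) :
      ∑ x, (f x - c) ^ 2 = ∑ x, f x ^ 2 - 2 * c * ∑ x, f x + ∑ _x : X, c ^ 2 := by
    rw [Finset.mul_sum, ← Finset.sum_sub_distrib, ← Finset.sum_add_distrib]
    exact Finset.sum_congr rfl fun x _ => by ring
  rw [key, key, h1, h2]

/-- The squared distance of a function to the sums of functions pulled back along independent
quotient maps. -/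
lemma sum_sub_fiberAvg_sq {ι : Type*} [Fintype ι] {H : ι → Type*} [∀ j, AddCommGroup (H j)]
    [∀ j, Fintype (H j)] [∀ j, DecidableEq (H j)] (π : ∀ j, G →+ H j)
    (hπ : ∀ j, Function.Surjective (π j))
    (hind : ∀ i j, i ≠ j → ∀ h : H j, ∃ g, π i g = 0 ∧ π j g = h) (V : G → ℝ) (v : ℝ)
    (hv : Fintype.card G * v = ∑ n, V n) :
    ∑ n, (V n - v - ∑ j, (fiberAvg (π j) V (π j n) - v)) ^ 2 =
      ∑ n, (V n - v) ^ 2 - ∑ j, ∑ n, (fiberAvg (π j) V (π j n) - v) ^ 2 := by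
  have hsum (j : ι) : ∑ n, (fiberAvg (π j) V (π j n) - v) = 0 := by
    have := sum_comp_mul_eq_sum_comp_mul_fiberAvg (π j) (hπ j) (fun _ => 1) V
    simp only [one_mul] at this
    rw [Finset.sum_sub_distrib, ← this, ← hv]
    simp
  have hcard (j : ι) : (Fintype.card (H j) : ℝ) ≠ 0 := by exact_mod_cast Fintype.card_ne_zero
  refine sum_sub_sum_sq (fun n => V n - v) (fun j n => fiberAvg (π j) V (π j n) - v) ?_ ?_
  · intro i j hij
    have := card_mul_sum_comp_mul_comp (π i) (π j) (hind i j hij)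
      (fun h => fiberAvg (π i) V h - v) (fun h => fiberAvg (π j) V h - v)
    rw [hsum, zero_mul] at this
    exact (mul_eq_zero.1 this).resolve_left (hcard j)
  · intro j
    have := sum_comp_mul_eq_sum_comp_mul_fiberAvg (π j) (hπ j) (fun h => fiberAvg (π j) V h - v) V
    simp only [mul_sub, Finset.sum_sub_distrib, this, pow_two]

end Orthogonality

lemma blockEmb_injective {d r : ℕ} (ds : Fin r → ℕ) (hsum : ∑ m, ds m = d) (j : Fin r) :
    Function.Injective (blockEmb ds hsum j) := by
  intro b c h
  simp only [blockEmb, Fin.mk.injEq] at h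
  exact Fin.ext (by omega)

lemma blockEmb_ne {d r : ℕ} (ds : Fin r → ℕ) (hsum : ∑ m, ds m = d) {i j : Fin r} (hij : i ≠ j)
    (b : Fin (ds i)) (c : Fin (ds j)) : blockEmb ds hsum i b ≠ blockEmb ds hsum j c := by
  have key {i j : Fin r} (h : i < j) : blockOffset ds i + ds i ≤ blockOffset ds j := by
    have hi : i ∉ Finset.univ.filter (fun m : Fin r => m < i) := by simp
    rw [blockOffset, blockOffset, add_comm, ← Finset.sum_insert hi]
    refine Finset.sum_le_sum_of_subset fun m hm => ?_
    simp only [Finset.mem_insert, Finset.mem_filter, Finset.mem_univ, true_and] at hm ⊢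
    rcases hm with rfl | hm
    · exact h
    · exact hm.trans h
  intro h
  simp only [blockEmb, Fin.mk.injEq] at h
  rcases lt_or_gt_of_ne hij with h' | h' <;> have := key h' <;> omega

/-- If real-valued Γ-periodic potentials `V` and `Y` are Floquet isospectral
and `Y = ⊕ Yⱼ` is separable, then `V = ⊕ Vⱼ` is separable and, up to constants summing to
zero, `Vⱼ` and `Yⱼ + cⱼ` are Floquet isospectral. -/
theorem stmt2 {d r : ℕ} (hd : 1 ≤ d) (hr : 2 ≤ r)
    (q : Fin d → ℕ) [∀ i, NeZero (q i)]
    (ds : Fin r → ℕ) (hds : ∀ j, 1 ≤ ds j) (hsum : ∑ m, ds m = d)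
    (V Y : (∀ i, ZMod (q i)) → ℝ)
    (Yj : ∀ j : Fin r, ((∀ b : Fin (ds j), ZMod (q (blockEmb ds hsum j b))) → ℝ))
    (hY : ∀ n, Y n = ∑ j, Yj j (fun b => n (blockEmb ds hsum j b)))
    (hiso : FloquetIso q (fun n => (V n : ℂ)) (fun n => (Y n : ℂ))) :
    ∃ Vj : ∀ j : Fin r, ((∀ b : Fin (ds j), ZMod (q (blockEmb ds hsum j b))) → ℝ),
      (∀ n, V n = ∑ j, Vj j (fun b => n (blockEmb ds hsum j b))) ∧
      ∃ c : Fin r → ℝ, (∑ j, c j) = 0 ∧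
        ∀ j : Fin r, FloquetIso (fun b => q (blockEmb ds hsum j b))
          (fun m => (Vj j m : ℂ)) (fun m => ((Yj j m + c j : ℝ) : ℂ)) := by
  let π (j : Fin r) := restrictHom q (blockEmb ds hsum j)
  have hinj (j : Fin r) := blockEmb_injective ds hsum j
  have hπ (j : Fin r) : Function.Surjective (π j) := restrictHom_surjective q _ (hinj j)
  have hind (i j : Fin r) (hij : i ≠ j) (h : ∀ b, ZMod (q (blockEmb ds hsum j b))) :
      ∃ g, π i g = 0 ∧ π j g = h :=
    ⟨extendZero q _ h, restrictHom_extendZero_of_disjoint q _ _ (blockEmb_ne ds hsum hij) h,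
      restrictHom_extendZero q _ (hinj j) h⟩
  have hcard (j : Fin r) :
      (Fintype.card (∀ b, ZMod (q (blockEmb ds hsum j b))) : ℝ) ≠ 0 := by
    exact_mod_cast Fintype.card_ne_zero
  let μ (j : Fin r) : ℝ :=
    (∑ x, Yj j x) / Fintype.card (∀ b, ZMod (q (blockEmb ds hsum j b)))
  obtain ⟨hm1, hm2⟩ := hiso.moments_eq
  have hvY : Fintype.card (∀ i, ZMod (q i)) * ∑ j, μ j = ∑ n, Y n := by
    simp_rw [hY]
    rw [Finset.sum_comm, Finset.mul_sum]
    refine Finset.sum_congr rfl fun j _ => ?_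
    rw [mul_div_assoc', div_eq_iff (hcard j), mul_comm _ (Fintype.card _ : ℝ)]
    exact (card_mul_sum_comp (π j) (hπ j) (Yj j)).symm
  have hYavg (j : Fin r) (h) : fiberAvg (π j) Y h = Yj j h + (∑ i, μ i - μ j) := by
    have hYfun : Y = fun n => ∑ i, Yj i (π i n) := funext hY
    have hlin : fiberAvg (π j) Y h = ∑ i, fiberAvg (π j) (fun n => Yj i (π i n)) h := by
      simp only [fiberAvg, hYfun, ← Finset.mul_sum]
      congr 1
      rw [Finset.sum_comm]
      refine Finset.sum_congr rfl fun n _ => ?_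
      split_ifs <;> simp
    rw [hlin, ← Finset.add_sum_erase _ _ (Finset.mem_univ j), fiberAvg_comp_self (π j) (hπ j),
      ← Finset.add_sum_erase _ μ (Finset.mem_univ j), add_sub_cancel_left]
    congr 1
    refine Finset.sum_congr rfl fun i hi => ?_
    exact fiberAvg_comp_of_indep (π j) (hπ j) (π i)
      (hind j i (Finset.ne_of_mem_erase hi).symm) (Yj i) h
  have hisoAvg (j : Fin r) : FloquetIso (fun b => q (blockEmb ds hsum j b))
      (fun h => ((fiberAvg (π j) V h : ℝ) : ℂ)) (fun h => ((fiberAvg (π j) Y h : ℝ) : ℂ)) := by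
    have hcast (V : (∀ i, ZMod (q i)) → ℝ) : (fun h => ((fiberAvg (π j) V h : ℝ) : ℂ)) =
        fiberAvg (π j) fun n => (V n : ℂ) := by
      funext h
      simp [fiberAvg, apply_ite Complex.ofReal]
    rw [hcast, hcast]
    exact hiso.fiberAvg _ (hinj j)
  have hdefect := sum_sub_fiberAvg_sq π hπ hind V (∑ j, μ j) (hvY.trans hm1.symm)
  have hV : ∀ n, V n = ∑ j, (fiberAvg (π j) V (π j n) - (∑ i, μ i - μ j)) := by
    have hzero : ∑ n, (V n - ∑ j, μ j - ∑ j, (fiberAvg (π j) V (π j n) - ∑ i, μ i)) ^ 2 = 0 := by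
      have hdefectY := sum_sub_fiberAvg_sq π hπ hind Y (∑ j, μ j) hvY
      have hYzero : ∑ n, (Y n - ∑ j, μ j - ∑ j, (fiberAvg (π j) Y (π j n) - ∑ i, μ i)) ^ 2
          = 0 := by
        refine Finset.sum_eq_zero fun n _ => ?_
        have : ∑ j, (fiberAvg (π j) Y (π j n) - ∑ i, μ i) = Y n - ∑ j, μ j := by
          rw [hY, ← Finset.sum_sub_distrib]
          refine Finset.sum_congr rfl fun j _ => ?_
          rw [hYavg, add_sub_assoc, sub_sub_cancel_left, ← sub_eq_add_neg]
          rfl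
        rw [this, sub_self, zero_pow two_ne_zero]
      have hblock (j : Fin r) : ∑ n, (fiberAvg (π j) V (π j n) - ∑ i, μ i) ^ 2 =
          ∑ n, (fiberAvg (π j) Y (π j n) - ∑ i, μ i) ^ 2 := by
        obtain ⟨h1, h2⟩ := (hisoAvg j).moments_eq
        have h3 := sum_sub_const_sq_eq (∑ i, μ i) h1 h2
        have hc := card_mul_sum_comp (K := ℝ) (π j) (hπ j)
        rw [← mul_right_inj' (hcard j), hc fun h => (fiberAvg (π j) V h - ∑ i, μ i) ^ 2,
          hc fun h => (fiberAvg (π j) Y h - ∑ i, μ i) ^ 2, h3]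
      rw [hdefect, sum_sub_const_sq_eq _ hm1 hm2, Finset.sum_congr rfl fun j _ => hblock j,
        ← hdefectY, hYzero]
    intro n
    have hn := (Finset.sum_eq_zero_iff_of_nonneg fun n _ => sq_nonneg _).1 hzero n
      (Finset.mem_univ n)
    have hn' := pow_eq_zero_iff two_ne_zero |>.1 hn
    simp only [← sub_add, Finset.sum_add_distrib]
    linarith
  refine ⟨fun j h => fiberAvg (π j) V h - (∑ i, μ i - μ j), hV, 0, by simp, fun j => ?_⟩
  have := (hisoAvg j).add_const (-((∑ i, μ i - μ j : ℝ) : ℂ))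
  convert this using 2 with h h
  · push_cast
    ring
  · rw [hYavg]
    simp only [Pi.zero_apply, add_zero]
    push_cast
    ring

end DPSO
end
end
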